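/- arXiv:1211.5031 — 2 statements merged into one kernel-verified Lean document; each statement's English description precedes it below -/
import Mathlib

section
/- Every connected subcubic multigraph G not isomorphic to G_3 has a 3-edge-colorable subgraph with at least (7/9)·|E(G)| edges, where G_3 is the multigraph obtained from a triangle K_3 by doubling one edge. -/
/-- A multigraph: a type of edges with an endpoint map, with no loops. -/
structure Multigraph (V E : Type*) where
  ends : E → Sym2 V
  loopless : ∀ e, ¬ (ends e).IsDiag

/-- Isomorphism of multigraphs. -/
def Multigraph.Iso {V E V' E' : Type*} (M : Multigraph V E) (M' : Multigraph V' E') : Prop :=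
  ∃ (σ : V ≃ V') (τ : E ≃ E'), ∀ e, M'.ends (τ e) = (M.ends e).map σ

/-- The multigraph `G₃`: a triangle with one edge doubled. -/
def G3 : Multigraph (Fin 3) (Fin 4) where
  ends := ![s((0 : Fin 3), (1 : Fin 3)), s((0 : Fin 3), (1 : Fin 3)),
            s((1 : Fin 3), (2 : Fin 3)), s((0 : Fin 3), (2 : Fin 3))]
  loopless := by decide

namespace Multigraph

open Classical Finset

section Involutions

variable {V : Type*}

/-- In a dihedral orbit of a fixed point of `t`, the involution `s` has at most one fixed point,
as soon as it has one. -/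
lemma eq_of_fixed_of_mem_orbit {s t : Equiv.Perm V} (hs : s * s = 1) (ht : t * t = 1)
    {w v v' : V} (hw : t w = w) (hv : s v = v) (hv' : s v' = v') {k l : ℤ}
    (hk : ((t * s) ^ k) w = v) (hl : ((t * s) ^ l) w = v') : v = v' := by
  have hs' : s⁻¹ = s := inv_eq_of_mul_eq_one_left hs
  have ht' : t⁻¹ = t := inv_eq_of_mul_eq_one_left ht
  have period : ∀ {x : V} {n : ℤ}, s x = x → ((t * s) ^ n) w = x →
      ((t * s) ^ (2 * n + 1)) w = w := by
    intro x n hx hn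
    have hconj : s * (t * s) ^ n * s⁻¹ = (t * s) ^ (-n) := by
      rw [← conj_zpow, zpow_neg, ← inv_zpow, mul_inv_rev, ht', hs', mul_assoc, mul_assoc, hs,
        mul_one]
    have h1 : ((t * s) ^ (-n)) (s w) = x := by
      rw [← hconj]
      simp [hn, hx]
    have h2 : s w = ((t * s) ^ (-1 : ℤ)) w := by
      simp [hs', ht', hw]
    rw [h2, ← Equiv.Perm.mul_apply, ← zpow_add, ← hn] at h1
    have h3 := congrArg ((t * s) ^ (n + 1)) h1
    rw [← Equiv.Perm.mul_apply, ← Equiv.Perm.mul_apply, ← zpow_add, ← zpow_add] at h3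
    rw [show n + 1 + (-n + -1) = 0 by ring, show n + 1 + n = 2 * n + 1 by ring] at h3
    simpa using h3.symm
  have pk := period hv hk
  have pl := period hv' hl
  let H := MulAction.stabilizer (Equiv.Perm V) w
  have mk : (t * s) ^ (2 * k + 1) ∈ H := pk
  have ml : (t * s) ^ (2 * l + 1) ∈ H := pl
  have key : (t * s) ^ (-l + k) ∈ H := by
    have := H.mul_mem (H.zpow_mem mk (-l)) (H.zpow_mem ml k)
    rw [← zpow_mul, ← zpow_mul, ← zpow_add] at this
    convert this using 2
    ring
  have key' : ((t * s) ^ (-l + k)) w = w := key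
  rw [← hk, ← hl]
  have := congrArg ((t * s) ^ l) key'
  rw [← Equiv.Perm.mul_apply, ← zpow_add] at this
  simpa using this

end Involutions

variable {V E : Type*} {M : Multigraph V E}

/-- A partial proper edge coloring with three colors; `none` marks the uncolored edges. -/
def Proper (M : Multigraph V E) (c : E → Option (Fin 3)) : Prop :=
  ∀ e f a x, c e = some a → c f = some a → x ∈ M.ends e → x ∈ M.ends f → e = f

/-- The colors present at a vertex. -/
noncomputable def seen (M : Multigraph V E) (c : E → Option (Fin 3)) (x : V) : Finset (Fin 3) :=
  {a | ∃ e, x ∈ M.ends e ∧ c e = some a}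

variable {c : E → Option (Fin 3)}

@[simp] lemma mem_seen {x : V} {a : Fin 3} :
    a ∈ M.seen c x ↔ ∃ e, x ∈ M.ends e ∧ c e = some a := by simp [seen]

lemma ne_of_ends {e : E} {u v : V} (he : M.ends e = s(u, v)) : u ≠ v := by
  rintro rfl
  exact M.loopless e (by simp [he])

lemma Proper.exists_involution (hc : M.Proper c) (a : Fin 3) :
    ∃ s : Equiv.Perm V, s * s = 1 ∧
      (∀ e x y, c e = some a → M.ends e = s(x, y) → s x = y) ∧
      ∀ x, a ∉ M.seen c x → s x = x := by
  have h : ∀ x : V, ∃ y : V, (∀ e z, c e = some a → M.ends e = s(x, z) → z = y) ∧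
      (a ∉ M.seen c x → y = x) ∧ (a ∈ M.seen c x → ∃ e, c e = some a ∧ M.ends e = s(x, y)) := by
    intro x
    by_cases hx : a ∈ M.seen c x
    · obtain ⟨e, hxe, he⟩ := mem_seen.1 hx
      obtain ⟨y, hy⟩ := hxe
      refine ⟨y, fun f z hf hz => ?_, fun h => absurd hx h, fun _ => ⟨e, he, hy⟩⟩
      have hfe := hc e f a x he hf (by simp [hy]) (by simp [hz])
      subst hfe
      rw [hy] at hz
      exact (Sym2.congr_right.1 hz).symm
    · refine ⟨x, fun e z he hz => ?_, fun _ => rfl, fun h => absurd h hx⟩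
      exact absurd (mem_seen.2 ⟨e, by simp [hz], he⟩) hx
  choose s hs hfix hedge using h
  have hinv : Function.Involutive s := by
    intro x
    by_cases hx : a ∈ M.seen c x
    · obtain ⟨e, he, hxe⟩ := hedge x hx
      exact (hs (s x) e x he (by rw [hxe, Sym2.eq_swap])).symm
    · rw [hfix x hx, hfix x hx]
  refine ⟨hinv.toPerm s, ?_, ?_, ?_⟩
  · ext x
    exact hinv x
  · intro e x y he hxy
    exact (hs x e y he hxy).symm
  · exact fun x hx => hfix x hx

/-- A set closed under edges of colors `a` and `b`, containing a vertex `w` that misses `b` and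
avoiding one of two given vertices that miss `a`. -/
lemma Proper.exists_kempe_set (hc : M.Proper c) {a b : Fin 3} {w v v' : V}
    (hw : b ∉ M.seen c w) (hv : a ∉ M.seen c v) (hv' : a ∉ M.seen c v') (hvv' : v ≠ v') :
    ∃ S : Set V, w ∈ S ∧ (v ∉ S ∨ v' ∉ S) ∧
      ∀ e, c e = some a ∨ c e = some b → ∀ x ∈ M.ends e, ∀ y ∈ M.ends e, x ∈ S → y ∈ S := by
  obtain ⟨s, hs, hse, hsf⟩ := hc.exists_involution a
  obtain ⟨t, ht, hte, htf⟩ := hc.exists_involution b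
  have hs' : s⁻¹ = s := inv_eq_of_mul_eq_one_left hs
  have ht' : t⁻¹ = t := inv_eq_of_mul_eq_one_left ht
  have htw := htf w hw
  have hconj : ∀ k : ℤ, t * (t * s) ^ k * t⁻¹ = (t * s) ^ (-k) := by
    intro k
    rw [← conj_zpow, zpow_neg, ← inv_zpow]
    congr 1
    rw [mul_inv_rev, hs', ht', ← mul_assoc, ht, one_mul]
  have htS : ∀ x, (∃ k : ℤ, ((t * s) ^ k) w = x) → ∃ k : ℤ, ((t * s) ^ k) w = t x := by
    rintro x ⟨k, rfl⟩
    refine ⟨-k, ?_⟩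
    rw [← hconj]
    simp [ht', htw]
  have hsS : ∀ x, (∃ k : ℤ, ((t * s) ^ k) w = x) → ∃ k : ℤ, ((t * s) ^ k) w = s x := by
    rintro x ⟨k, rfl⟩
    obtain ⟨l, hl⟩ := htS _ ⟨1 + k, rfl⟩
    refine ⟨l, ?_⟩
    rw [hl, zpow_add, zpow_one, ← Equiv.Perm.mul_apply, ← Equiv.Perm.mul_apply, ← mul_assoc,
      ← mul_assoc, ht, one_mul]
  refine ⟨{x | ∃ k : ℤ, ((t * s) ^ k) w = x}, ⟨0, by simp⟩, ?_, ?_⟩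
  · by_contra! h
    obtain ⟨⟨k, hk⟩, ⟨l, hl⟩⟩ := h
    exact hvv' (eq_of_fixed_of_mem_orbit hs ht htw (hsf v hv) (hsf v' hv') hk hl)
  · intro e he x hx y hy hxS
    by_cases hxy : x = y
    · rwa [← hxy]
    have hends : M.ends e = s(x, y) := (Sym2.mem_and_mem_iff hxy).1 ⟨hx, hy⟩
    rcases he with he | he
    · rw [← hse e x y he hends]
      exact hsS x hxS
    · rw [← hte e x y he hends]
      exact htS x hxS

/-- Kempe exchange of the colors `a` and `b` on the edges that meet `S`. -/
noncomputable def kempe (M : Multigraph V E) (c : E → Option (Fin 3)) (a b : Fin 3) (S : Set V) :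
    E → Option (Fin 3) :=
  fun e => if ∃ x ∈ S, x ∈ M.ends e then (c e).map (Equiv.swap a b) else c e

lemma kempe_eq_of_mem {a b d : Fin 3} {S : Set V} {e : E} {x : V} (hx : x ∈ M.ends e)
    (hxS : x ∈ S) : M.kempe c a b S e = some d ↔ c e = some (Equiv.swap a b d) := by
  rw [kempe, if_pos ⟨x, hxS, hx⟩]
  rcases c e with _ | f
  · simp
  · simp [Equiv.swap_apply_eq_iff]

lemma kempe_eq_of_notMem {a b d : Fin 3} {S : Set V} {e : E} {x : V}
    (hS : ∀ e, c e = some a ∨ c e = some b → ∀ x ∈ M.ends e, ∀ y ∈ M.ends e, x ∈ S → y ∈ S)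
    (hx : x ∈ M.ends e) (hxS : x ∉ S) : M.kempe c a b S e = some d ↔ c e = some d := by
  rw [kempe]
  split_ifs with h
  · obtain ⟨y, hyS, hy⟩ := h
    rcases hce : c e with _ | f
    · simp
    · have hfa : f ≠ a := fun h => hxS (hS e (by simp [hce, h]) y hy x hx hyS)
      have hfb : f ≠ b := fun h => hxS (hS e (by simp [hce, h]) y hy x hx hyS)
      simp [Equiv.swap_apply_of_ne_of_ne hfa hfb]
  · rfl

lemma Proper.kempe (hc : M.Proper c) {a b : Fin 3} {S : Set V}
    (hS : ∀ e, c e = some a ∨ c e = some b → ∀ x ∈ M.ends e, ∀ y ∈ M.ends e, x ∈ S → y ∈ S) :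
    M.Proper (M.kempe c a b S) := by
  intro e f d x he hf hxe hxf
  by_cases hxS : x ∈ S
  · rw [kempe_eq_of_mem hxe hxS] at he
    rw [kempe_eq_of_mem hxf hxS] at hf
    exact hc e f _ x he hf hxe hxf
  · rw [kempe_eq_of_notMem hS hxe hxS] at he
    rw [kempe_eq_of_notMem hS hxf hxS] at hf
    exact hc e f _ x he hf hxe hxf

lemma Proper.update_none (hc : M.Proper c) (e : E) : M.Proper (Function.update c e none) := by
  intro f g a x hf hg hxf hxg
  simp only [Function.update_apply] at hf hg
  split_ifs at hf hg
  exact hc f g a x hf hg hxf hxg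

lemma Proper.update_some (hc : M.Proper c) {e : E} {a : Fin 3}
    (h : ∀ x ∈ M.ends e, a ∉ M.seen c x) : M.Proper (Function.update c e (some a)) := by
  intro f g d x hf hg hxf hxg
  simp only [Function.update_apply] at hf hg
  split_ifs at hf hg with h1 h2 h2
  · rw [h1, h2]
  · subst h1
    obtain rfl : a = d := by simpa using hf
    exact absurd (mem_seen.2 ⟨g, hxg, hg⟩) (h x hxf)
  · subst h2
    obtain rfl : a = d := by simpa using hg
    exact absurd (mem_seen.2 ⟨f, hxf, hf⟩) (h x hxg)
  · exact hc f g d x hf hg hxf hxg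

/-- The edge `g` may take over the role of the uncolored edge `e`. -/
def Rotates (M : Multigraph V E) (c : E → Option (Fin 3)) (e g : E) : Prop :=
  g = e ∨ ∃ u v a, M.ends e = s(u, v) ∧ v ∈ M.ends g ∧ c g = some a ∧ a ∉ M.seen c u

/-- Color `e` with the color of `g` and uncolor `g`. -/
noncomputable def move (c : E → Option (Fin 3)) (e g : E) : E → Option (Fin 3) :=
  Function.update (Function.update c e (c g)) g none

@[simp] lemma move_right (e g : E) : move c e g g = none := by simp [move]

lemma move_of_ne {e g f : E} (he : f ≠ e) (hg : f ≠ g) : move c e g f = c f := by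
  simp [move, he, hg]

lemma Rotates.exists_mem {e g : E} (h : M.Rotates c e g) : ∃ x ∈ M.ends e, x ∈ M.ends g := by
  obtain rfl | ⟨u, v, a, huv, hv, -⟩ := h
  · exact ⟨_, Sym2.out_fst_mem _, Sym2.out_fst_mem _⟩
  · exact ⟨v, by simp [huv], hv⟩

/-- An edge of color `a` at `v`, where `a` is missing at the other end `u` of the uncolored edge
`e`, leads to a third vertex. -/
lemma exists_third {e : E} {u v : V} {a : Fin 3} (huv : M.ends e = s(u, v))
    (hav : a ∈ M.seen c v) (hau : a ∉ M.seen c u) :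
    ∃ g w, M.ends g = s(v, w) ∧ c g = some a ∧ M.Rotates c e g ∧ w ≠ u ∧ w ≠ v := by
  obtain ⟨g, ⟨w, hw⟩, hg⟩ := mem_seen.1 hav
  refine ⟨g, w, hw, hg, Or.inr ⟨u, v, a, huv, by simp [hw], hg, hau⟩, ?_, (ne_of_ends hw).symm⟩
  rintro rfl
  exact hau (mem_seen.2 ⟨g, by simp [hw], hg⟩)

variable [Fintype E]

/-- The edges incident with a vertex. -/
noncomputable def inc (M : Multigraph V E) (x : V) : Finset E := {e | x ∈ M.ends e}

/-- The uncolored edges. -/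
noncomputable def unc (c : E → Option (Fin 3)) : Finset E := {e | c e = none}

/-- A proper partial coloring with as few uncolored edges as possible. -/
def Optimal (M : Multigraph V E) (c : E → Option (Fin 3)) : Prop :=
  M.Proper c ∧ ∀ c', M.Proper c' → #(unc c) ≤ #(unc c')

@[simp] lemma mem_inc {x : V} {e : E} : e ∈ M.inc x ↔ x ∈ M.ends e := by simp [inc]


@[simp] lemma mem_unc {e : E} : e ∈ unc c ↔ c e = none := by simp [unc]

lemma unc_kempe (a b : Fin 3) (S : Set V) : unc (M.kempe c a b S) = unc c := by
  ext e
  simp only [mem_unc, kempe]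
  split_ifs <;> simp

lemma Optimal.exists_seen (hc : M.Optimal c) {e : E} (he : c e = none) (a : Fin 3) :
    ∃ x ∈ M.ends e, a ∈ M.seen c x := by
  by_contra! h
  have hle := hc.2 _ (hc.1.update_some h)
  have hlt : #(unc (Function.update c e (some a))) < #(unc c) := by
    apply card_lt_card
    refine (ssubset_iff_of_subset fun f hf => ?_).2 ⟨e, by simpa, by simp⟩
    simp only [mem_unc, Function.update_apply] at hf ⊢
    split_ifs at hf
    exact hf
  omega

lemma Optimal.mem_seen_or (hc : M.Optimal c) {e : E} (he : c e = none) {u v : V}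
    (huv : M.ends e = s(u, v)) (a : Fin 3) : a ∈ M.seen c u ∨ a ∈ M.seen c v := by
  obtain ⟨x, hx, hax⟩ := hc.exists_seen he a
  rw [huv, Sym2.mem_iff] at hx
  rcases hx with rfl | rfl
  · exact Or.inl hax
  · exact Or.inr hax

lemma Optimal.three_le (hc : M.Optimal c) {e : E} (he : c e = none) {u v : V}
    (huv : M.ends e = s(u, v)) : 3 ≤ #(M.seen c u) + #(M.seen c v) := by
  have h : M.seen c u ∪ M.seen c v = univ := by
    ext a
    simpa only [mem_union, mem_univ, iff_true] using hc.mem_seen_or he huv a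
  have := card_union_le (M.seen c u) (M.seen c v)
  rw [h] at this
  simpa using this

/-- Every edge at a vertex is uncolored or accounts for its own color. -/
lemma Proper.card_seen_add (hc : M.Proper c) (x : V) :
    #(M.seen c x) + #{e ∈ M.inc x | c e = none} = #(M.inc x) := by
  have h : #{e ∈ M.inc x | ¬ c e = none} = #(M.seen c x) := by
    refine card_bij (fun e he => (c e).get (Option.isSome_iff_ne_none.2 (mem_filter.1 he).2))
      ?_ ?_ ?_
    · intro e he
      exact mem_seen.2 ⟨e, by simpa using (mem_filter.1 he).1, by simp⟩
    · intro e he f hf hef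
      obtain ⟨a, ha⟩ := Option.ne_none_iff_exists'.1 (mem_filter.1 he).2
      obtain ⟨b, hb⟩ := Option.ne_none_iff_exists'.1 (mem_filter.1 hf).2
      obtain rfl : a = b := by simpa [ha, hb] using hef
      exact hc e f a x ha hb (by simpa using (mem_filter.1 he).1)
        (by simpa using (mem_filter.1 hf).1)
    · intro a ha
      obtain ⟨e, hxe, he⟩ := mem_seen.1 ha
      exact ⟨e, by simp [hxe, he], by simp [he]⟩
  have := card_filter_add_card_filter_not (s := M.inc x) (fun e => c e = none)
  omega

lemma Proper.card_seen_lt (hc : M.Proper c) {x : V} {e : E} (hx : x ∈ M.ends e)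
    (he : c e = none) : #(M.seen c x) + 1 ≤ #(M.inc x) := by
  have h1 := hc.card_seen_add x
  have h2 : 0 < #{e ∈ M.inc x | c e = none} := card_pos.2 ⟨e, by simp [hx, he]⟩
  omega

lemma Proper.card_seen_add_two_le (hc : M.Proper c) {x : V} {e f : E} (hef : e ≠ f)
    (hxe : x ∈ M.ends e) (hxf : x ∈ M.ends f) (he : c e = none) (hf : c f = none) :
    #(M.seen c x) + 2 ≤ #(M.inc x) := by
  have h1 := hc.card_seen_add x
  have h2 : 1 < #{e ∈ M.inc x | c e = none} :=
    one_lt_card.2 ⟨e, by simp [hxe, he], f, by simp [hxf, hf], hef⟩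
  omega

/-- In an optimal coloring the uncolored edges form a matching. -/
lemma Optimal.eq_of_mem (hdeg : ∀ x, #(M.inc x) ≤ 3) (hc : M.Optimal c) {e f : E} {w : V}
    (he : c e = none) (hf : c f = none) (hwe : w ∈ M.ends e) (hwf : w ∈ M.ends f) : e = f := by
  by_contra hef
  obtain ⟨v, hv⟩ := hwe
  obtain ⟨v', hv'⟩ := hwf
  have hw2 := hc.1.card_seen_add_two_le hef (x := w) (by simp [hv]) (by simp [hv']) he hf
  have hw3 := hdeg w
  have hw1 : #(M.seen c w) ≤ 1 := by omega
  have missed : ∀ {g : E} {x : V}, c g = none → M.ends g = s(w, x) → ∀ a ∈ M.seen c w,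
      a ∉ M.seen c x := by
    intro g x hg hx a haw hax
    have hx1 := hc.1.card_seen_lt (x := x) (by simp [hx]) hg
    have hx3 := hdeg x
    have h : M.seen c w ∪ M.seen c x = univ := by
      ext a
      simpa only [mem_union, mem_univ, iff_true] using hc.mem_seen_or hg hx a
    have h1 := card_union_add_card_inter (M.seen c w) (M.seen c x)
    have h2 : 0 < #(M.seen c w ∩ M.seen c x) := card_pos.2 ⟨a, mem_inter.2 ⟨haw, hax⟩⟩
    rw [h] at h1
    simp at h1
    omega
  have hvv' : v ≠ v' := by
    rintro rfl
    have h1 := hc.three_le he hv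
    have h2 := hc.1.card_seen_add_two_le hef (x := v) (by simp [hv]) (by simp [hv']) he hf
    have h3 := hdeg v
    omega
  have hwpos : 0 < #(M.seen c w) := by
    have h1 := hc.three_le he hv
    have h2 := hc.1.card_seen_lt (x := v) (by simp [hv]) he
    have h3 := hdeg v
    omega
  obtain ⟨a, ha⟩ := card_pos.1 hwpos
  obtain ⟨b, hb⟩ : ∃ b, b ∉ M.seen c w := by
    by_contra! h
    rw [eq_univ_of_forall h] at hw1
    simp at hw1
  obtain ⟨S, hwS, hvS, hS⟩ := hc.1.exists_kempe_set hb (missed he hv a ha) (missed hf hv' a ha) hvv'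
  have hopt : M.Optimal (M.kempe c a b S) := ⟨hc.1.kempe hS, by rw [unc_kempe]; exact hc.2⟩
  have hwa : a ∉ M.seen (M.kempe c a b S) w := by
    rw [mem_seen]
    rintro ⟨g, hwg, hg⟩
    rw [kempe_eq_of_mem hwg hwS, Equiv.swap_apply_left] at hg
    exact hb (mem_seen.2 ⟨g, hwg, hg⟩)
  have contra : ∀ {g : E} {x : V}, c g = none → M.ends g = s(w, x) → x ∉ S → False := by
    intro g x hg hx hxS
    have hg' : M.kempe c a b S g = none := by
      rw [← mem_unc, unc_kempe, mem_unc, hg]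
    rcases hopt.mem_seen_or hg' hx a with h | h
    · exact hwa h
    · obtain ⟨k, hxk, hk⟩ := mem_seen.1 h
      rw [kempe_eq_of_notMem hS hxk hxS] at hk
      exact missed hg hx a ha (mem_seen.2 ⟨k, hxk, hk⟩)
  exact hvS.elim (contra he hv) (contra hf hv')

lemma coe_inc (x : V) : (M.inc x : Set E) = {e | x ∈ M.ends e} := by simp [inc]

lemma unc_move {e g : E} (he : c e = none) (h : M.Rotates c e g) :
    unc (move c e g) = insert g ((unc c).erase e) := by
  ext f
  simp only [mem_unc, mem_insert, mem_erase]
  by_cases hfg : f = g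
  · simp [hfg]
  · by_cases hfe : f = e
    · subst hfe
      obtain rfl | ⟨u, v, a, -, -, ha, -⟩ := h
      · exact absurd rfl hfg
      · simp [move, hfg, ha]
    · simp [move_of_ne hfe hfg, hfg, hfe]

lemma Optimal.move (hc : M.Optimal c) {e g : E} (he : c e = none) (h : M.Rotates c e g) :
    M.Optimal (move c e g) := by
  refine ⟨?_, fun c' hc' => ?_⟩
  · obtain rfl | ⟨u, v, a, huv, hv, ha, hu⟩ := h
    · rw [Multigraph.move, Function.update_idem]
      exact hc.1.update_none _
    · have hge : e ≠ g := by
        rintro rfl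
        simp [he] at ha
      rw [Multigraph.move, Function.update_comm hge, ha]
      refine (hc.1.update_none g).update_some fun x hx h => ?_
      obtain ⟨f, hxf, hf⟩ := mem_seen.1 h
      have hfg : f ≠ g := by
        rintro rfl
        simp at hf
      rw [Function.update_of_ne hfg] at hf
      rw [huv, Sym2.mem_iff] at hx
      rcases hx with rfl | rfl
      · exact hu (mem_seen.2 ⟨f, hxf, hf⟩)
      · exact hfg (hc.1 f g a x hf ha hxf hv)
  · refine le_trans ?_ (hc.2 c' hc')
    rw [unc_move he h]
    refine (card_insert_le _ _).trans ?_
    rw [card_erase_add_one (mem_unc.2 he)]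

/-- The vertices charged to the uncolored edge `e`: those that `e` reaches by one rotation. -/
noncomputable def charged [Fintype V] (M : Multigraph V E) (c : E → Option (Fin 3)) (e : E) :
    Finset V :=
  {x | ∃ g, M.Rotates c e g ∧ x ∈ M.ends g}

lemma mem_charged [Fintype V] {e : E} {x : V} :
    x ∈ M.charged c e ↔ ∃ g, M.Rotates c e g ∧ x ∈ M.ends g := by simp [charged]

lemma Rotates.disjoint (hdeg : ∀ x, #(M.inc x) ≤ 3) (hc : M.Optimal c) {e f g : E}
    (he : c e = none) (hf : c f = none) (hef : e ≠ f) (h : M.Rotates c e g) :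
    ∀ x ∈ M.ends f, x ∉ M.ends g := by
  intro x hxf hxg
  have hfg : g ≠ f := by
    obtain rfl | ⟨u, v, a, -, -, ha, -⟩ := h
    · exact hef
    · rintro rfl
      simp [hf] at ha
  exact hfg ((hc.move he h).eq_of_mem hdeg (move_right e g)
    (by rw [move_of_ne hef.symm hfg.symm, hf]) hxg hxf)

lemma Optimal.disjoint_charged [Fintype V] (hdeg : ∀ x, #(M.inc x) ≤ 3) (hc : M.Optimal c)
    {e f : E} (he : c e = none) (hf : c f = none) (hef : e ≠ f) :
    Disjoint (M.charged c e) (M.charged c f) := by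
  rw [Finset.disjoint_left]
  intro x hx hx'
  obtain ⟨g, hg, hxg⟩ := mem_charged.1 hx
  obtain ⟨h, hh, hxh⟩ := mem_charged.1 hx'
  have hfg := hg.disjoint hdeg hc he hf hef
  have heh := hh.disjoint hdeg hc hf he hef.symm
  obtain ⟨z, hze, hzg⟩ := hg.exists_mem
  obtain ⟨y, hyf, hyh⟩ := hh.exists_mem
  have hhe : h ≠ e := by
    rintro rfl
    exact heh z hze hze
  have hhg : h ≠ g := by
    rintro rfl
    exact hfg y hyf hyh
  have hfg' : f ≠ g := by
    rintro rfl
    exact hfg y hyf hyf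
  have hf' : Multigraph.move c e g f = none := by rw [move_of_ne hef.symm hfg', hf]
  have hrot : M.Rotates (Multigraph.move c e g) f h := by
    obtain rfl | ⟨u, v, a, huv, hv, ha, hu⟩ := hh
    · exact Or.inl rfl
    · refine Or.inr ⟨u, v, a, huv, hv, by rw [move_of_ne hhe hhg, ha], fun hs => hu ?_⟩
      obtain ⟨k, huk, hk⟩ := mem_seen.1 hs
      have huf : u ∈ M.ends f := by simp [huv]
      have hkg : k ≠ g := by
        rintro rfl
        exact hfg u huf huk
      have hke : k ≠ e := by
        rintro rfl
        exact hef (hc.eq_of_mem hdeg he hf huk huf)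
      rw [move_of_ne hke hkg] at hk
      exact mem_seen.2 ⟨k, huk, hk⟩
  exact hhg (((hc.move he hg).move hf' hrot).eq_of_mem hdeg (move_right f h)
    (by rw [move_of_ne hfg'.symm hhg.symm, move_right]) hxh hxg)

lemma Optimal.two_le_of_mem (hdeg : ∀ x, #(M.inc x) ≤ 3) (hc : M.Optimal c) {e : E} {x : V}
    (he : c e = none) (hx : x ∈ M.ends e) : 2 ≤ #(M.inc x) := by
  obtain ⟨y, hy⟩ := hx
  have h1 := hc.three_le he hy
  have h2 := hc.1.card_seen_lt (x := x) (by simp [hy]) he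
  have h3 := hc.1.card_seen_lt (x := y) (by simp [hy]) he
  have h4 := hdeg y
  omega

lemma Optimal.two_le_of_rotates (hdeg : ∀ x, #(M.inc x) ≤ 3) (hc : M.Optimal c) {e g : E} {x : V}
    (he : c e = none) (h : M.Rotates c e g) (hx : x ∈ M.ends g) : 2 ≤ #(M.inc x) :=
  (hc.move he h).two_le_of_mem hdeg (move_right e g) hx

/-- The uncolored edges both of whose ends have degree three. -/
noncomputable def bad (M : Multigraph V E) (c : E → Option (Fin 3)) : Finset E :=
  {e ∈ unc c | ∀ x ∈ M.ends e, #(M.inc x) = 3}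

/-- A triangle with one doubled edge is a component of any subcubic multigraph containing it. -/
lemma iso_G3 (hconn : ∀ u v : V, Relation.ReflTransGen (fun a b => ∃ e, M.ends e = s(a, b)) u v)
    (hdeg : ∀ x, #(M.inc x) ≤ 3) {e g h k : E} {u v p : V} (he : M.ends e = s(u, v))
    (hg : M.ends g = s(v, p)) (hh : M.ends h = s(u, p)) (hk : M.ends k = s(u, p)) (hhk : h ≠ k)
    (hv : #(M.inc v) = 2) : M.Iso G3 := by
  have huv := ne_of_ends he
  have hvp := ne_of_ends hg
  have hup := ne_of_ends hh
  have heg : e ≠ g := by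
    rintro rfl
    rw [he, Sym2.eq_iff] at hg
    tauto
  have heh : e ≠ h := by
    rintro rfl
    rw [he, Sym2.eq_iff] at hh
    tauto
  have hek : e ≠ k := by
    rintro rfl
    rw [he, Sym2.eq_iff] at hk
    tauto
  have hgh : g ≠ h := by
    rintro rfl
    rw [hg, Sym2.eq_iff] at hh
    tauto
  have hgk : g ≠ k := by
    rintro rfl
    rw [hg, Sym2.eq_iff] at hk
    tauto
  have incu : ({e, h, k} : Finset E) = M.inc u := by
    refine eq_of_subset_of_card_le ?_ ((hdeg u).trans_eq (card_eq_three.2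
      ⟨e, h, k, heh, hek, hhk, rfl⟩).symm)
    simp [insert_subset_iff, he, hh, hk]
  have incp : ({g, h, k} : Finset E) = M.inc p := by
    refine eq_of_subset_of_card_le ?_ ((hdeg p).trans_eq (card_eq_three.2
      ⟨g, h, k, hgh, hgk, hhk, rfl⟩).symm)
    simp [insert_subset_iff, hg, hh, hk]
  have incv : ({e, g} : Finset E) = M.inc v := by
    refine eq_of_subset_of_card_le ?_ (hv.trans (card_pair heg).symm).le
    simp [insert_subset_iff, he, hg]
  have edges : ∀ x f, (x = p ∨ x = u ∨ x = v) → x ∈ M.ends f → f = h ∨ f = k ∨ f = e ∨ f = g := by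
    rintro x f (rfl | rfl | rfl) hf
    · have := mem_inc.2 hf
      rw [← incp] at this
      simp at this
      tauto
    · have := mem_inc.2 hf
      rw [← incu] at this
      simp at this
      tauto
    · have := mem_inc.2 hf
      rw [← incv] at this
      simp at this
      tauto
  have verts : ∀ x, x = p ∨ x = u ∨ x = v := by
    intro x
    induction hconn u x with
    | refl => simp
    | @tail y z _ hyz ih =>
      obtain ⟨f, hf⟩ := hyz
      have hzf : z ∈ M.ends f := by simp [hf]
      rcases edges y f ih (by simp [hf]) with rfl | rfl | rfl | rfl
      · rw [hh, Sym2.mem_iff] at hzf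
        tauto
      · rw [hk, Sym2.mem_iff] at hzf
        tauto
      · rw [he, Sym2.mem_iff] at hzf
        tauto
      · rw [hg, Sym2.mem_iff] at hzf
        tauto
  have hσ : Function.Bijective ![p, u, v] := by
    constructor
    · intro i j
      fin_cases i <;> fin_cases j <;> simp [huv, hvp, hup, huv.symm, hvp.symm, hup.symm]
    · intro x
      rcases verts x with rfl | rfl | rfl
      exacts [⟨0, rfl⟩, ⟨1, rfl⟩, ⟨2, rfl⟩]
  have hτ : Function.Bijective ![h, k, e, g] := by
    constructor
    · intro i j
      fin_cases i <;> fin_cases j <;>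
        simp [heg, heh, hek, hgh, hgk, hhk, heg.symm, heh.symm, hek.symm, hgh.symm, hgk.symm,
          hhk.symm]
    · intro f
      obtain ⟨x, hx⟩ : ∃ x, x ∈ M.ends f := ⟨_, Sym2.out_fst_mem _⟩
      rcases edges x f (verts x) hx with rfl | rfl | rfl | rfl
      exacts [⟨0, rfl⟩, ⟨1, rfl⟩, ⟨2, rfl⟩, ⟨3, rfl⟩]
  let σ := Equiv.ofBijective _ hσ
  let τ := Equiv.ofBijective _ hτ
  have key : ∀ i, (G3.ends i).map σ = M.ends (τ i) := by
    intro i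
    fin_cases i <;> simp [G3, σ, τ, hh, hk, he, hg, Sym2.eq_swap]
  refine ⟨σ.symm, τ.symm, fun f => ?_⟩
  obtain ⟨i, rfl⟩ := τ.surjective f
  rw [← key, Equiv.symm_apply_apply, Sym2.map_map, Equiv.symm_comp_self, Sym2.map_id, id]

lemma nine_le_of_subset [Fintype V] {T S : Finset V} (h : S ⊆ T)
    (hS : 9 ≤ ∑ x ∈ S, #(M.inc x)) : 9 ≤ ∑ x ∈ T, #(M.inc x) :=
  hS.trans (sum_le_sum_of_subset h)

lemma Optimal.nine_le_of_two [Fintype V]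
    (hconn : ∀ u v : V, Relation.ReflTransGen (fun a b => ∃ e, M.ends e = s(a, b)) u v)
    (hdeg : ∀ x, #(M.inc x) ≤ 3) (hniso : ¬ M.Iso G3) (hc : M.Optimal c) {e : E} {u v : V}
    (he : c e = none) (huv : M.ends e = s(u, v)) (hu : #(M.inc u) = 3) (hv : #(M.inc v) = 2) :
    9 ≤ ∑ x ∈ M.charged c e, #(M.inc x) := by
  have hvu : M.ends e = s(v, u) := by rw [huv, Sym2.eq_swap]
  have h3 := hc.three_le he huv
  have hsu := hc.1.card_seen_lt (x := u) (by simp [huv]) he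
  have hsv := hc.1.card_seen_lt (x := v) (by simp [huv]) he
  have hdisj : Disjoint (M.seen c u) (M.seen c v) := by
    rw [← card_union_eq_card_add_card]
    refine le_antisymm (card_union_le _ _) ?_
    have h : M.seen c u ∪ M.seen c v = univ := by
      ext a
      simpa only [mem_union, mem_univ, iff_true] using hc.mem_seen_or he huv a
    rw [h]
    simp
    omega
  obtain ⟨a, ha⟩ : ∃ a, a ∈ M.seen c v := card_pos.1 (by omega)
  obtain ⟨b, d, hbd, hsbd⟩ := card_eq_two.1 (show #(M.seen c u) = 2 by omega)
  have hb : b ∈ M.seen c u := by simp [hsbd]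
  have hd : d ∈ M.seen c u := by simp [hsbd]
  obtain ⟨g, r, hg, hga, hrg, hru, hrv⟩ := exists_third huv ha (disjoint_right.1 hdisj ha)
  obtain ⟨h, p, hh, hhb, hrh, hpv, hpu⟩ := exists_third hvu hb (disjoint_left.1 hdisj hb)
  obtain ⟨k, q, hk, hkd, hrk, hqv, hqu⟩ := exists_third hvu hd (disjoint_left.1 hdisj hd)
  have mem : ∀ {f x}, M.Rotates c e f → x ∈ M.ends f → x ∈ M.charged c e :=
    fun hf hx => mem_charged.2 ⟨_, hf, hx⟩
  have four : ∀ {x y}, x ≠ u → x ≠ v → y ≠ u → y ≠ v → x ≠ y → x ∈ M.charged c e →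
      y ∈ M.charged c e → 2 ≤ #(M.inc x) → 2 ≤ #(M.inc y) →
      9 ≤ ∑ x ∈ M.charged c e, #(M.inc x) := by
    intro x y hxu hxv hyu hyv hxy hx hy hx2 hy2
    refine nine_le_of_subset (S := {u, v, x, y}) ?_ ?_
    · simp [insert_subset_iff, hx, hy, mem (f := e) (Or.inl rfl), huv]
    · rw [sum_insert (by simp [ne_of_ends huv, hxu.symm, hyu.symm]),
        sum_insert (by simp [hxv.symm, hyv.symm]), sum_pair hxy]
      omega
  have hr := mem (x := r) hrg (by simp [hg])
  have hp := mem (x := p) hrh (by simp [hh])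
  have hq := mem (x := q) hrk (by simp [hk])
  have hr2 := hc.two_le_of_rotates hdeg (x := r) he hrg (by simp [hg])
  have hp2 := hc.two_le_of_rotates hdeg (x := p) he hrh (by simp [hh])
  have hq2 := hc.two_le_of_rotates hdeg (x := q) he hrk (by simp [hk])
  by_cases hrp : r = p
  · by_cases hpq : p = q
    · subst hrp hpq
      refine absurd (iso_G3 hconn hdeg huv hg hh hk ?_ hv) hniso
      rintro rfl
      exact hbd (by simpa [hhb] using hkd)
    · exact four hpu hpv hqu hqv hpq hp hq hp2 hq2
  · exact four hru hrv hpu hpv hrp hr hp hr2 hp2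

lemma Optimal.nine_le_of_three [Fintype V] (hc : M.Optimal c)
    (hbad : ∀ c', M.Optimal c' → #(M.bad c) ≤ #(M.bad c')) {e : E} {u v : V}
    (he : c e = none) (huv : M.ends e = s(u, v)) (hu : #(M.inc u) = 3) (hv : #(M.inc v) = 3) :
    9 ≤ ∑ x ∈ M.charged c e, #(M.inc x) := by
  have hsu := hc.1.card_seen_lt (x := u) (by simp [huv]) he
  obtain ⟨a, ha⟩ : ∃ a, a ∉ M.seen c u := by
    by_contra! h
    rw [eq_univ_of_forall h] at hsu
    simp at hsu
    omega
  obtain ⟨g, p, hg, hga, hrg, hpu, hpv⟩ :=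
    exists_third huv ((hc.mem_seen_or he huv a).resolve_left ha) ha
  have mem : ∀ {f x}, M.Rotates c e f → x ∈ M.ends f → x ∈ M.charged c e :=
    fun hf hx => mem_charged.2 ⟨_, hf, hx⟩
  have hue := mem (x := u) (f := e) (Or.inl rfl) (by simp [huv])
  have hve := mem (x := v) (f := e) (Or.inl rfl) (by simp [huv])
  have hp := mem (x := p) hrg (by simp [hg])
  have hp3 : #(M.inc p) = 3 := by
    by_contra hp3
    have hlt : #(M.bad (Multigraph.move c e g)) < #(M.bad c) := by
      apply card_lt_card
      refine (ssubset_iff_of_subset fun f hf => ?_).2 ⟨e, ?_, ?_⟩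
      · simp only [bad, mem_filter, unc_move he hrg, mem_insert, mem_erase] at hf ⊢
        obtain ⟨rfl | hf, hf3⟩ := hf
        · exact absurd (hf3 p (by simp [hg])) hp3
        · exact ⟨hf.2, hf3⟩
      · simp [bad, he, huv, hu, hv]
      · simp only [bad, mem_filter, unc_move he hrg, mem_insert, mem_erase]
        rintro ⟨rfl | hf, hf3⟩
        · simp [he] at hga
        · exact hf.1 rfl
    exact absurd (hbad _ (hc.move he hrg)) (by omega)
  refine nine_le_of_subset (S := {u, v, p}) (by simp [insert_subset_iff, hue, hve, hp]) ?_
  rw [sum_insert (by simp [ne_of_ends huv, hpu.symm]), sum_pair hpv.symm]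
  omega

lemma Optimal.nine_le [Fintype V]
    (hconn : ∀ u v : V, Relation.ReflTransGen (fun a b => ∃ e, M.ends e = s(a, b)) u v)
    (hdeg : ∀ x, #(M.inc x) ≤ 3) (hniso : ¬ M.Iso G3) (hc : M.Optimal c)
    (hbad : ∀ c', M.Optimal c' → #(M.bad c) ≤ #(M.bad c')) {e : E} (he : c e = none) :
    9 ≤ ∑ x ∈ M.charged c e, #(M.inc x) := by
  obtain ⟨u, v, huv⟩ : ∃ u v, M.ends e = s(u, v) :=
    Sym2.ind (f := fun z => ∃ u v, z = s(u, v)) (fun u v => ⟨u, v, rfl⟩) (M.ends e)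
  have hvu : M.ends e = s(v, u) := by rw [huv, Sym2.eq_swap]
  have h3 := hc.three_le he huv
  have hsu := hc.1.card_seen_lt (x := u) (by simp [huv]) he
  have hsv := hc.1.card_seen_lt (x := v) (by simp [huv]) he
  have hu := hdeg u
  have hv := hdeg v
  obtain ⟨hu, hv⟩ | ⟨hu, hv⟩ | ⟨hu, hv⟩ : (#(M.inc u) = 3 ∧ #(M.inc v) = 3) ∨
      (#(M.inc u) = 3 ∧ #(M.inc v) = 2) ∨ (#(M.inc v) = 3 ∧ #(M.inc u) = 2) := by omega
  · exact hc.nine_le_of_three hbad he huv hu hv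
  · exact hc.nine_le_of_two hconn hdeg hniso he huv hu hv
  · exact hc.nine_le_of_two hconn hdeg hniso he hvu hu hv

lemma sum_card_inc [Fintype V] (M : Multigraph V E) :
    ∑ x, #(M.inc x) = 2 * Fintype.card E := by
  have h := sum_card_bipartiteAbove_eq_sum_card_bipartiteBelow (s := (univ : Finset V))
    (t := (univ : Finset E)) (fun x e => x ∈ M.ends e)
  simp only [bipartiteAbove, bipartiteBelow] at h
  refine h.trans ?_
  have h2 : ∀ e : E, #{x | x ∈ M.ends e} = 2 := by
    intro e
    obtain ⟨u, v, huv⟩ : ∃ u v, M.ends e = s(u, v) :=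
      Sym2.ind (f := fun z => ∃ u v, z = s(u, v)) (fun u v => ⟨u, v, rfl⟩) (M.ends e)
    refine card_eq_two.2 ⟨u, v, ne_of_ends huv, ?_⟩
    ext x
    simp [huv]
  rw [sum_congr rfl fun e _ => h2 e]
  simp [mul_comm]

lemma exists_optimal (M : Multigraph V E) :
    ∃ c, M.Optimal c ∧ ∀ c', M.Optimal c' → #(M.bad c) ≤ #(M.bad c') := by
  have h1 : ∃ c, M.Proper c := ⟨fun _ => none, fun e f a x h => by simp at h⟩
  obtain ⟨c₀, hc₀, hmin⟩ := exists_min_image (univ.filter M.Proper) (fun c => #(unc c))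
    (by simpa [Finset.Nonempty] using h1)
  have h2 : M.Optimal c₀ := ⟨by simpa using hc₀, fun c' hc' => hmin c' (by simpa)⟩
  obtain ⟨c, hc, hbad⟩ := exists_min_image (univ.filter M.Optimal) (fun c => #(M.bad c))
    ⟨c₀, by simpa⟩
  exact ⟨c, by simpa using hc, fun c' hc' => hbad c' (by simpa)⟩

/-- At most two ninths of the edges need to stay uncolored. -/
lemma exists_proper_nine_mul_le [Fintype V]
    (hconn : ∀ u v : V, Relation.ReflTransGen (fun a b => ∃ e, M.ends e = s(a, b)) u v)
    (hdeg : ∀ x, #(M.inc x) ≤ 3) (hniso : ¬ M.Iso G3) :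
    ∃ c, M.Proper c ∧ 9 * #(unc c) ≤ 2 * Fintype.card E := by
  obtain ⟨c, hc, hbad⟩ := M.exists_optimal
  refine ⟨c, hc.1, ?_⟩
  calc 9 * #(unc c) = ∑ e ∈ unc c, 9 := by rw [sum_const, smul_eq_mul, mul_comm]
    _ ≤ ∑ e ∈ unc c, ∑ x ∈ M.charged c e, #(M.inc x) :=
      sum_le_sum fun e he => hc.nine_le hconn hdeg hniso hbad (mem_unc.1 he)
    _ = ∑ x ∈ (unc c).biUnion (M.charged c), #(M.inc x) := by
      refine (sum_biUnion fun e he f hf hef => ?_).symm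
      exact hc.disjoint_charged hdeg (mem_unc.1 he) (mem_unc.1 hf) hef
    _ ≤ ∑ x, #(M.inc x) := sum_le_sum_of_subset (subset_univ _)
    _ = 2 * Fintype.card E := M.sum_card_inc

end Multigraph

/-- Every connected subcubic multigraph not isomorphic to `G₃` has a 3-edge-colorable
subgraph with at least `(7/9)·|E|` edges. -/
theorem stmt9 {V E : Type*} [Fintype V] [Fintype E] (M : Multigraph V E)
    (hconn : ∀ u v : V, Relation.ReflTransGen (fun a b => ∃ e, M.ends e = s(a, b)) u v)
    (hdeg : ∀ v : V, {e : E | v ∈ M.ends e}.ncard ≤ 3)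
    (hniso : ¬ M.Iso G3) :
    ∃ F : Finset E,
      (∃ c : E → ℕ, (∀ e ∈ F, c e < 3) ∧
        ∀ e₁ ∈ F, ∀ e₂ ∈ F, e₁ ≠ e₂ →
          (∃ v, v ∈ M.ends e₁ ∧ v ∈ M.ends e₂) → c e₁ ≠ c e₂) ∧
      (7 : ℚ) / 9 * Fintype.card E ≤ F.card := by
  classical
  obtain ⟨c, hc, hcard⟩ := Multigraph.exists_proper_nine_mul_le hconn (fun x => by
    have h := hdeg x
    rwa [← Multigraph.coe_inc, Set.ncard_coe_finset] at h) hniso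
  refine ⟨(Multigraph.unc c)ᶜ, ⟨fun e => (c e).elim 0 Fin.val, ?_, ?_⟩, ?_⟩
  · intro e _
    rcases h : c e with _ | a <;> simp [h]
  · rintro e he f hf hef ⟨x, hxe, hxf⟩ h
    obtain ⟨a, ha⟩ := Option.ne_none_iff_exists'.1 (by simpa using he)
    obtain ⟨b, hb⟩ := Option.ne_none_iff_exists'.1 (by simpa using hf)
    have hab : a = b := Fin.ext (by simpa [ha, hb] using h)
    exact hef (hc e f a x ha (hab ▸ hb) hxe hxf)
  · have h := Finset.card_compl_add_card (Multigraph.unc c)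
    have h' : (Fintype.card E : ℚ) = ((Multigraph.unc c)ᶜ.card : ℚ) + (Multigraph.unc c).card := by
      exact_mod_cast h.symm
    have h'' : (9 : ℚ) * (Multigraph.unc c).card ≤ 2 * Fintype.card E := by exact_mod_cast hcard
    linarith
end

section
/- Every connected simple subcubic graph G not isomorphic to B_3 has a 3-edge-colorable subgraph with at least (13/15)·|E(G)| edges, where B_3 is the graph obtained from K_4 by subdividing one edge. -/
/-- A proper edge coloring of (the edges of) `G` using colors `< k`. -/
def IsProperEdgeColoring {V : Type*} (G : SimpleGraph V) (k : ℕ) (c : Sym2 V → ℕ) : Prop :=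
  (∀ e ∈ G.edgeSet, c e < k) ∧
  ∀ e₁ ∈ G.edgeSet, ∀ e₂ ∈ G.edgeSet, e₁ ≠ e₂ → (∃ v, v ∈ e₁ ∧ v ∈ e₂) → c e₁ ≠ c e₂

/-- The graph `B₃`: `K₄` with one edge subdivided. -/
def B3 : SimpleGraph (Fin 5) :=
  SimpleGraph.fromEdgeSet
    {s((0 : Fin 5), (2 : Fin 5)), s((0 : Fin 5), (3 : Fin 5)), s((1 : Fin 5), (2 : Fin 5)),
     s((1 : Fin 5), (3 : Fin 5)), s((2 : Fin 5), (3 : Fin 5)), s((0 : Fin 5), (4 : Fin 5)),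
     s((1 : Fin 5), (4 : Fin 5))}

/-- The vertices reachable from `p` by repeatedly applying `f` and `g`; for the partial
matchings of two colours this is a Kempe chain. -/
inductive KempeChain {V : Type*} (f g : V → V) (p : V) : V → Prop
  | refl : KempeChain f g p p
  | left {x : V} : KempeChain f g p x → KempeChain f g p (f x)
  | right {x : V} : KempeChain f g p x → KempeChain f g p (g x)

namespace KempeChain

variable {V : Type*} {f g : V → V} {p q x y : V}

theorem swap (h : KempeChain f g p x) : KempeChain g f p x := by
  induction h with
  | refl => exact refl
  | left _ ih => exact ih.right
  | right _ ih => exact ih.left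

theorem trans (h : KempeChain f g p x) (h' : KempeChain f g x y) : KempeChain f g p y := by
  induction h' with
  | refl => exact h
  | left _ ih => exact ih.left
  | right _ ih => exact ih.right

theorem symm (hf : Function.Involutive f) (hg : Function.Involutive g)
    (h : KempeChain f g p x) : KempeChain f g x p := by
  induction h with
  | refl => exact refl
  | @left z _ ih =>
    have h1 : KempeChain f g (f z) (f (f z)) := refl.left
    rw [hf z] at h1
    exact h1.trans ih
  | @right z _ ih =>
    have h1 : KempeChain f g (g z) (g (g z)) := refl.right
    rw [hg z] at h1
    exact h1.trans ih

theorem mem_of_closed {S : V → Prop} (h : KempeChain f g p x) (hp : S p)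
    (hf : ∀ y, S y → S (f y)) (hg : ∀ y, S y → S (g y)) : S x := by
  induction h with
  | refl => exact hp
  | left _ ih => exact hf _ ih
  | right _ ih => exact hg _ ih

theorem left_iff (hf : Function.Involutive f) :
    KempeChain f g p (f x) ↔ KempeChain f g p x :=
  ⟨fun h => by simpa [hf x] using h.left, left⟩

theorem right_iff (hg : Function.Involutive g) :
    KempeChain f g p (g x) ↔ KempeChain f g p x :=
  ⟨fun h => by simpa [hg x] using h.right, right⟩

end KempeChain

open scoped Classical in
/-- The alternating sequence `q, f q, g (f q), f (g (f q)), …`. -/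
noncomputable def altSeq {V : Type*} (f g : V → V) (q : V) : ℕ → V
  | 0 => q
  | n + 1 => if Even n then f (altSeq f g q n) else g (altSeq f g q n)

section altSeq

variable {V : Type*} {f g : V → V} {p q x y : V}

theorem altSeq_succ_even {n : ℕ} (h : Even n) :
    altSeq f g q (n + 1) = f (altSeq f g q n) := by
  simp [altSeq, h]

theorem altSeq_succ_odd {n : ℕ} (h : ¬ Even n) :
    altSeq f g q (n + 1) = g (altSeq f g q n) := by
  simp only [altSeq, if_neg h]

theorem left_altSeq (hf : Function.Involutive f) (n : ℕ) :
    (Even n ∧ f (altSeq f g q n) = altSeq f g q (n + 1)) ∨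
      ∃ k, n = k + 1 ∧ f (altSeq f g q n) = altSeq f g q k := by
  by_cases h : Even n
  · exact .inl ⟨h, (altSeq_succ_even h).symm⟩
  · obtain ⟨k, rfl⟩ : ∃ k, n = k + 1 := ⟨n - 1, by grind⟩
    refine .inr ⟨k, rfl, ?_⟩
    rw [altSeq_succ_even (by grind), hf]

theorem right_altSeq (hg : Function.Involutive g) (hq : g q = q) (n : ℕ) :
    (¬ Even n ∧ g (altSeq f g q n) = altSeq f g q (n + 1)) ∨
      (n = 0 ∧ g (altSeq f g q n) = altSeq f g q n) ∨
      ∃ k, n = k + 1 ∧ g (altSeq f g q n) = altSeq f g q k := by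
  by_cases h : Even n
  · rcases n with _ | k
    · exact .inr (.inl ⟨rfl, hq⟩)
    · refine .inr (.inr ⟨k, rfl, ?_⟩)
      rw [altSeq_succ_odd (by grind), hg]
  · exact .inl ⟨h, (altSeq_succ_odd h).symm⟩

theorem KempeChain.exists_altSeq_eq (hf : Function.Involutive f) (hg : Function.Involutive g)
    (hq : g q = q) (h : KempeChain f g q x) : ∃ i, altSeq f g q i = x := by
  refine h.mem_of_closed (S := fun x => ∃ i, altSeq f g q i = x) ⟨0, rfl⟩ ?_ ?_
  · rintro _ ⟨i, rfl⟩
    rcases left_altSeq (g := g) (q := q) hf i with ⟨-, h⟩ | ⟨k, -, h⟩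
    · exact ⟨_, h.symm⟩
    · exact ⟨_, h.symm⟩
  · rintro _ ⟨i, rfl⟩
    rcases right_altSeq (f := f) hg hq i with ⟨-, h⟩ | ⟨-, h⟩ | ⟨k, -, h⟩ <;> exact ⟨_, h.symm⟩

theorem KempeChain.exists_altSeq_eq_of_stationary (hf : Function.Involutive f)
    (hg : Function.Involutive g) (hq : g q = q) {i : ℕ}
    (hi : altSeq f g q (i + 1) = altSeq f g q i) (h : KempeChain f g q x) :
    ∃ j ≤ i, altSeq f g q j = x := by
  refine h.mem_of_closed (S := fun x => ∃ j ≤ i, altSeq f g q j = x) ⟨0, by omega, rfl⟩ ?_ ?_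
  · rintro _ ⟨j, hj, rfl⟩
    rcases left_altSeq (g := g) (q := q) hf j with ⟨-, h⟩ | ⟨k, hk, h⟩
    · rcases hj.eq_or_lt with rfl | hj
      · exact ⟨j, le_rfl, by rw [h, hi]⟩
      · exact ⟨_, hj, h.symm⟩
    · exact ⟨k, by omega, h.symm⟩
  · rintro _ ⟨j, hj, rfl⟩
    rcases right_altSeq (f := f) hg hq j with ⟨-, h⟩ | ⟨-, h⟩ | ⟨k, hk, h⟩
    · rcases hj.eq_or_lt with rfl | hj
      · exact ⟨j, le_rfl, by rw [h, hi]⟩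
      · exact ⟨_, hj, h.symm⟩
    · exact ⟨j, hj, h.symm⟩
    · exact ⟨k, by omega, h.symm⟩

/-- The index at which an alternating path starting at `q` reaches its other end `p`. -/
theorem KempeChain.exists_altSeq_end (hf : Function.Involutive f) (hg : Function.Involutive g)
    (hq : g q = q) (hp : f p = p) (h : KempeChain f g q p) :
    ∃ m, altSeq f g q m = p ∧ (∀ j < m, altSeq f g q j ≠ p) ∧
      altSeq f g q (m + 1) = altSeq f g q m := by
  have hex := h.exists_altSeq_eq hf hg hq
  classical
  refine ⟨Nat.find hex, Nat.find_spec hex, fun j hj => Nat.find_min hex hj, ?_⟩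
  have h1 := Nat.find_spec hex
  have h2 : ∀ j < Nat.find hex, altSeq f g q j ≠ p := fun j hj => Nat.find_min hex hj
  generalize Nat.find hex = m at h1 h2
  by_cases hm : Even m
  · rw [altSeq_succ_even hm, h1, hp]
  · obtain ⟨k, rfl⟩ : ∃ k, m = k + 1 := ⟨m - 1, by grind⟩
    rw [altSeq_succ_even (by grind)] at h1
    exact absurd (by rw [← hf (altSeq f g q k), h1, hp]) (h2 k (by omega))

theorem altSeq_injOn (hf : Function.Involutive f) (hg : Function.Involutive g)
    (hq : g q = q) (h : KempeChain f g q p) {i : ℕ} (hi : ∀ j < i, altSeq f g q j ≠ p)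
    (k : ℕ) : ∀ j, j < k → k ≤ i → altSeq f g q j ≠ altSeq f g q k := by
  induction k using Nat.strong_induction_on with
  | _ k ih =>
    intro j hjk hki heq
    obtain ⟨k, rfl⟩ : ∃ l, k = l + 1 := ⟨k - 1, by omega⟩
    have hstat : altSeq f g q (k + 1) ≠ altSeq f g q k := fun h' => by
      obtain ⟨l, hl, hl'⟩ := h.exists_altSeq_eq_of_stationary hf hg hq h'
      exact hi l (by omega) hl'
    have key : ∀ l ≤ k, altSeq f g q l = altSeq f g q k → l = k := fun l hl h' => by
      by_contra hne
      exact ih k (by omega) l (by omega) (by omega) h'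
    by_cases hk : Even k
    · rw [altSeq_succ_even hk] at heq hstat
      have h1 : f (altSeq f g q j) = altSeq f g q k := by rw [heq, hf]
      rcases left_altSeq (g := g) (q := q) hf j with ⟨h2, h3⟩ | ⟨l, h2, h3⟩
      · rcases (Nat.lt_succ_iff.mp hjk).eq_or_lt with rfl | hlt
        · exact hstat heq.symm
        · have := key (j + 1) hlt (by rw [← h3, h1])
          grind
      · have := key l (by omega) (by rw [← h3, h1])
        omega
    · rw [altSeq_succ_odd hk] at heq hstat
      have h1 : g (altSeq f g q j) = altSeq f g q k := by rw [heq, hg]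
      rcases right_altSeq (f := f) hg hq j with ⟨h2, h3⟩ | ⟨h2, h3⟩ | ⟨l, h2, h3⟩
      · rcases (Nat.lt_succ_iff.mp hjk).eq_or_lt with rfl | hlt
        · exact hstat heq.symm
        · have := key (j + 1) hlt (by rw [← h3, h1])
          grind
      · have := key j (by omega) (by rw [← h3, h1])
        grind
      · have := key l (by omega) (by rw [← h3, h1])
        omega

/-- A Kempe chain with ends `q` (missing the second colour) and `p` (missing the first) has no
other vertex missing the second colour. -/
theorem KempeChain.eq_of_right_fixed (hf : Function.Involutive f) (hg : Function.Involutive g)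
    (hq : g q = q) (hp : f p = p) (h : KempeChain f g q p) (hx : KempeChain f g q x)
    (hgx : g x = x) : x = q := by
  obtain ⟨m, hm, hlt, hst⟩ := h.exists_altSeq_end hf hg hq hp
  obtain ⟨j, hj, rfl⟩ := hx.exists_altSeq_eq_of_stationary hf hg hq hst
  have inj := altSeq_injOn hf hg hq h hlt
  rcases right_altSeq (f := f) hg hq j with ⟨h2, h3⟩ | ⟨rfl, h3⟩ | ⟨l, rfl, h3⟩
  · rcases hj.eq_or_lt with rfl | hj
    · obtain ⟨l, rfl⟩ : ∃ l, j = l + 1 := ⟨j - 1, by grind⟩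
      have h4 := altSeq_succ_even (f := f) (g := g) (q := q) (n := l) (by grind)
      refine absurd ?_ (hlt l (by omega))
      rw [← hf (altSeq f g q l), ← h4, hm, hp]
    · exact absurd (by rw [← h3, hgx]) (inj (j + 1) j (by omega) hj)
  · rfl
  · exact absurd (by rw [← h3, hgx]) (inj (l + 1) l (by omega) hj)

end altSeq

/-- A partial proper 3-edge-colouring of `G`, given by three edge-disjoint matchings: `σ i x` is
the neighbour of `x` along its edge of colour `i`, or `x` itself if that colour is missing. -/
structure PartialEdgeColoring {V : Type*} (G : SimpleGraph V) where
  σ : Fin 3 → V → V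
  invol : ∀ i, Function.Involutive (σ i)
  adj : ∀ i x, σ i x ≠ x → G.Adj x (σ i x)
  disj : ∀ i j x, i ≠ j → σ i x ≠ x → σ i x ≠ σ j x

/-- Every vertex has at most three neighbours. -/
def SimpleGraph.IsSubcubic {V : Type*} (G : SimpleGraph V) : Prop :=
  ∀ x, (G.neighborSet x).ncard ≤ 3

theorem SimpleGraph.IsSubcubic.eq_of_adj {V : Type*} [Finite V] {G : SimpleGraph V}
    (hG : G.IsSubcubic) {x a b c d : V} (ha : G.Adj x a) (hb : G.Adj x b) (hc : G.Adj x c)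
    (hd : G.Adj x d) (hab : a ≠ b) (hac : a ≠ c) (hbc : b ≠ c) : d = a ∨ d = b ∨ d = c := by
  by_contra! h
  have h4 : ({d, a, b, c} : Set V).ncard = 4 := Set.ncard_eq_four.mpr
    ⟨d, a, b, c, h.1, h.2.1, h.2.2, hab, hac, hbc, rfl⟩
  have hsub : ({d, a, b, c} : Set V) ⊆ G.neighborSet x := by
    rintro y (rfl | rfl | rfl | rfl) <;> assumption
  have := Set.ncard_le_ncard hsub
  have := hG x
  omega

theorem SimpleGraph.two_le_ncard {V : Type*} [Finite V] {G : SimpleGraph V} {x a b : V}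
    (ha : G.Adj x a) (hb : G.Adj x b) (hab : a ≠ b) : 2 ≤ (G.neighborSet x).ncard := by
  rw [← Set.ncard_pair hab]
  exact Set.ncard_le_ncard (by rintro y (rfl | rfl) <;> assumption)

theorem SimpleGraph.three_le_ncard {V : Type*} [Finite V] {G : SimpleGraph V} {x a b c : V}
    (ha : G.Adj x a) (hb : G.Adj x b) (hc : G.Adj x c) (hab : a ≠ b) (hac : a ≠ c)
    (hbc : b ≠ c) : 3 ≤ (G.neighborSet x).ncard := by
  rw [← Set.ncard_eq_three.mpr ⟨a, b, c, hab, hac, hbc, rfl⟩]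
  exact Set.ncard_le_ncard (by rintro y (rfl | rfl | rfl) <;> assumption)

namespace PartialEdgeColoring

variable {V : Type*} {G : SimpleGraph V} (c : PartialEdgeColoring G)

/-- The edge `xy` belongs to `G` but has no colour. -/
def Uncolored (x y : V) : Prop := G.Adj x y ∧ ∀ i, c.σ i x ≠ y

variable {c} in
theorem Uncolored.symm {x y : V} (h : c.Uncolored x y) : c.Uncolored y x :=
  ⟨h.1.symm, fun i hi => h.2 i (by rw [← hi, c.invol])⟩

theorem eq_of_apply_eq {i j : Fin 3} {x y : V} (hi : c.σ i x = y) (hj : c.σ j x = y)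
    (h : x ≠ y) : i = j := by
  by_contra hij
  exact c.disj i j x hij (by rw [hi]; exact h.symm) (by rw [hi, hj])

/-- The matchings obtained by moving colour `a` from the edge at `q` to the edge `pq`. -/
noncomputable def recolor {p q : V} {a : Fin 3} (h : c.Uncolored p q) (ha : c.σ a p = p) :
    PartialEdgeColoring G :=
  open scoped Classical in
  { σ := fun i x => if i = a then
      (if x = p then q else if x = q then p else if x = c.σ a q then x else c.σ a x)
      else c.σ i x
    invol := by
      intro i x
      have hpq := h.1.ne
      have h1 := c.invol a
      have h2 := c.invol i
      unfold Function.Involutive at h1 h2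
      grind
    adj := by
      intro i x
      have h1 := c.adj a x
      have h2 := c.adj i x
      have h3 := h.1
      have h4 := h.1.symm
      grind
    disj := by
      intro i j x hij
      have h1 := c.disj i j x hij
      have h2 := c.disj j i x hij.symm
      have h3 := h.2
      have h4 := h.symm.2
      grind }

theorem recolor_apply_of_ne {p q : V} {a i : Fin 3} (h : c.Uncolored p q) (ha : c.σ a p = p)
    (hi : i ≠ a) (x : V) : (c.recolor h ha).σ i x = c.σ i x := by
  simp [recolor, hi]

theorem recolor_apply_left {p q : V} {a : Fin 3} (h : c.Uncolored p q) (ha : c.σ a p = p) :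
    (c.recolor h ha).σ a p = q := by
  simp [recolor]

theorem recolor_apply_old {p q : V} {a : Fin 3} (h : c.Uncolored p q) (ha : c.σ a p = p)
    (hq : c.σ a q ≠ q) : (c.recolor h ha).σ a (c.σ a q) = c.σ a q := by
  have := h.symm.2 a
  simp [recolor, hq, this]

theorem recolor_apply_right {p q : V} {a : Fin 3} (h : c.Uncolored p q) (ha : c.σ a p = p) :
    (c.recolor h ha).σ a q = p := by
  simp [recolor, h.1.ne']

theorem recolor_apply_other {p q : V} {a : Fin 3} (h : c.Uncolored p q) (ha : c.σ a p = p)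
    {x : V} (hp : x ≠ p) (hq : x ≠ q) (hw : x ≠ c.σ a q) (i : Fin 3) :
    (c.recolor h ha).σ i x = c.σ i x := by
  by_cases hi : i = a
  · subst hi; simp [recolor, hp, hq, hw]
  · simp [recolor, hi]

theorem recolor_uncolored_iff {p q : V} {a : Fin 3} (h : c.Uncolored p q) (ha : c.σ a p = p)
    {x y : V} : (c.recolor h ha).Uncolored x y ↔
      (c.Uncolored x y ∧ ¬ (x = p ∧ y = q) ∧ ¬ (x = q ∧ y = p)) ∨
        (c.σ a q ≠ q ∧ (x = q ∧ y = c.σ a q ∨ x = c.σ a q ∧ y = q)) := by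
  have hpq := h.1.ne
  have h1 := h.symm.2 a
  have h5 := c.adj a q
  have h6 := c.invol a q
  have hu := h.2
  have hl := c.recolor_apply_left h ha
  have hr := c.recolor_apply_right h ha
  have ho := c.recolor_apply_old h ha
  have hx := fun hp hq hw i => c.recolor_apply_other h ha (x := x) hp hq hw i
  have hn := fun i hi => c.recolor_apply_of_ne h ha (i := i) hi
  have he := fun i j (x y : V) => c.eq_of_apply_eq (i := i) (j := j) (x := x) (y := y)
  unfold Uncolored
  constructor
  · rintro ⟨hadj, hun⟩
    have := hun a
    by_cases hxp : x = p
    · subst hxp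
      refine .inl ⟨⟨hadj, fun i => ?_⟩, ?_, ?_⟩
      · by_cases hi : i = a
        · subst hi; rw [ha]; exact hadj.ne
        · rw [← hn i hi]; exact hun i
      · rintro ⟨-, rfl⟩; exact this hl
      · rintro ⟨rfl, rfl⟩; exact hpq rfl
    by_cases hxq : x = q
    · subst hxq
      by_cases hy : y = c.σ a x
      · exact .inr ⟨by rw [← hy]; exact hadj.ne', .inl ⟨rfl, hy⟩⟩
      · refine .inl ⟨⟨hadj, fun i => ?_⟩, by grind, by grind⟩
        by_cases hi : i = a
        · subst hi; exact Ne.symm hy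
        · rw [← hn i hi]; exact hun i
    by_cases hxw : x = c.σ a q
    · by_cases hy : y = q
      · exact .inr ⟨by rw [← hxw]; exact hxq, .inr ⟨hxw, hy⟩⟩
      · refine .inl ⟨⟨hadj, fun i => ?_⟩, by grind, by grind⟩
        by_cases hi : i = a
        · subst hi; rw [hxw, h6]; exact Ne.symm hy
        · rw [← hn i hi]; exact hun i
    · exact .inl ⟨⟨hadj, fun i => by rw [← hx hxp hxq hxw]; exact hun i⟩, by grind, by grind⟩
  · rintro (⟨⟨hadj, hun⟩, h2, h3⟩ | ⟨hq, ⟨rfl, rfl⟩ | ⟨rfl, rfl⟩⟩)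
    · refine ⟨hadj, fun i => ?_⟩
      have := hun i
      by_cases hi : i = a
      · subst hi
        by_cases hxp : x = p
        · grind
        by_cases hxq : x = q
        · grind
        by_cases hxw : x = c.σ i q
        · have := hadj.ne; grind
        · rw [hx hxp hxq hxw]; exact this
      · rw [hn i hi]; exact this
    · refine ⟨h5 hq, fun i => ?_⟩
      by_cases hi : i = a
      · subst hi; rw [hr]; exact h1.symm
      · rw [hn i hi]; intro h'; exact hi (he i a _ _ h' rfl hq.symm)
    · refine ⟨(h5 hq).symm, fun i => ?_⟩
      by_cases hi : i = a
      · subst hi; rw [ho hq]; exact hq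
      · rw [hn i hi]; intro h'; exact hi (he i a _ _ h' h6 hq)

open scoped Classical in
/-- Exchange the colours `a` and `b` along the Kempe chain of `p`. -/
noncomputable def kempeSwap (a b : Fin 3) (p : V) : PartialEdgeColoring G :=
  { σ := fun i x => if KempeChain (c.σ a) (c.σ b) p x then c.σ (Equiv.swap a b i) x else c.σ i x
    invol := by
      intro i x
      have ha := KempeChain.left_iff (g := c.σ b) (p := p) (x := x) (c.invol a)
      have hb := KempeChain.right_iff (f := c.σ a) (p := p) (x := x) (c.invol b)
      have h1 := fun i => c.invol i x
      by_cases hia : i = a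
      · subst hia; simp only [Equiv.swap_apply_left]; split_ifs <;> grind
      by_cases hib : i = b
      · subst hib; simp only [Equiv.swap_apply_right]; split_ifs <;> grind
      · simp only [Equiv.swap_apply_of_ne_of_ne hia hib, ite_self]; exact h1 i
    adj := by
      intro i x
      have h1 := c.adj i x
      have h2 := c.adj (Equiv.swap a b i) x
      grind
    disj := by
      intro i j x hij
      have h1 := c.disj i j x hij
      have h2 := c.disj (Equiv.swap a b i) (Equiv.swap a b j) x (by simpa using hij)
      grind }

theorem kempeSwap_apply_of_mem {a b : Fin 3} {p x : V}
    (h : KempeChain (c.σ a) (c.σ b) p x) (i : Fin 3) :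
    (c.kempeSwap a b p).σ i x = c.σ (Equiv.swap a b i) x := by
  simp [kempeSwap, h]

theorem kempeSwap_apply_of_not_mem {a b : Fin 3} {p x : V}
    (h : ¬ KempeChain (c.σ a) (c.σ b) p x) (i : Fin 3) :
    (c.kempeSwap a b p).σ i x = c.σ i x := by
  simp [kempeSwap, h]

theorem kempeSwap_uncolored_iff {a b : Fin 3} {p x y : V} :
    (c.kempeSwap a b p).Uncolored x y ↔ c.Uncolored x y := by
  unfold Uncolored
  by_cases h : KempeChain (c.σ a) (c.σ b) p x
  · simp only [c.kempeSwap_apply_of_mem h]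
    exact and_congr_right fun _ =>
      (Equiv.swap a b).forall_congr_right (q := fun i => c.σ i x ≠ y)
  · simp only [c.kempeSwap_apply_of_not_mem h]

section Defect

variable [Fintype V]

open scoped Classical in
/-- The uncoloured edges, each listed in both orientations. -/
noncomputable def uncoloredDarts : Finset (V × V) :=
  Finset.univ.filter fun d => c.Uncolored d.1 d.2

theorem mem_uncoloredDarts {d : V × V} : d ∈ c.uncoloredDarts ↔ c.Uncolored d.1 d.2 := by
  simp [uncoloredDarts]

/-- No partial colouring leaves fewer edges uncoloured. -/
def IsOptimal : Prop :=
  ∀ c' : PartialEdgeColoring G, c.uncoloredDarts.card ≤ c'.uncoloredDarts.card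

theorem recolor_sum_le {p q : V} {a : Fin 3} (h : c.Uncolored p q) (ha : c.σ a p = p)
    (ω : V × V → ℕ) :
    ∑ d ∈ (c.recolor h ha).uncoloredDarts, ω d + (ω (p, q) + ω (q, p)) ≤
      ∑ d ∈ c.uncoloredDarts, ω d + (ω (q, c.σ a q) + ω (c.σ a q, q)) := by
  classical
  have hne : (p, q) ≠ (q, p) := fun h' => h.1.ne (congrArg Prod.fst h')
  have hsub : ({(p, q), (q, p)} : Finset (V × V)) ⊆ c.uncoloredDarts := by
    intro d hd
    simp only [Finset.mem_insert, Finset.mem_singleton] at hd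
    rw [mem_uncoloredDarts]
    rcases hd with rfl | rfl
    · exact h
    · exact h.symm
  have h1 : (c.recolor h ha).uncoloredDarts ⊆
      (c.uncoloredDarts \ {(p, q), (q, p)}) ∪ {(q, c.σ a q), (c.σ a q, q)} := by
    rintro ⟨x, y⟩ hd
    rw [mem_uncoloredDarts, recolor_uncolored_iff] at hd
    simp only [Finset.mem_union, Finset.mem_sdiff, mem_uncoloredDarts, Finset.mem_insert,
      Finset.mem_singleton, Prod.mk.injEq]
    grind
  have h2 := Finset.sum_le_sum_of_subset (f := ω) h1
  have h3 : ∀ s t : Finset (V × V), ∑ d ∈ s ∪ t, ω d ≤ ∑ d ∈ s, ω d + ∑ d ∈ t, ω d :=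
    fun s t => by rw [← Finset.sum_union_inter]; omega
  have h4 := h3 (c.uncoloredDarts \ {(p, q), (q, p)}) {(q, c.σ a q), (c.σ a q, q)}
  have h5 := Finset.sum_sdiff (f := ω) hsub
  rw [Finset.sum_pair hne] at h5
  have h6 : ∑ d ∈ ({(q, c.σ a q), (c.σ a q, q)} : Finset (V × V)), ω d ≤
      ω (q, c.σ a q) + ω (c.σ a q, q) := by
    by_cases hq : (q, c.σ a q) = (c.σ a q, q)
    · rw [hq]; simp
    · rw [Finset.sum_pair hq]
  omega

variable {c}

theorem IsOptimal.recolor (hc : c.IsOptimal) {p q : V} {a : Fin 3} (h : c.Uncolored p q)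
    (ha : c.σ a p = p) : (c.recolor h ha).IsOptimal := fun c' => by
  have := c.recolor_sum_le h ha fun _ => 1
  simp only [Finset.sum_const, smul_eq_mul, mul_one] at this
  have := hc c'
  omega

theorem IsOptimal.kempeSwap (hc : c.IsOptimal) (a b : Fin 3) (p : V) :
    (c.kempeSwap a b p).IsOptimal := fun c' => by
  have : (c.kempeSwap a b p).uncoloredDarts = c.uncoloredDarts := by
    ext d; simp only [mem_uncoloredDarts, kempeSwap_uncolored_iff]
  rw [this]
  exact hc c'

theorem IsOptimal.apply_ne (hc : c.IsOptimal) {p q : V} {a : Fin 3} (h : c.Uncolored p q)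
    (ha : c.σ a p = p) : c.σ a q ≠ q := by
  intro hq
  have hlt : (c.recolor h ha).uncoloredDarts ⊂ c.uncoloredDarts := by
    rw [Finset.ssubset_iff_of_subset]
    · refine ⟨(p, q), by simpa [mem_uncoloredDarts] using h, ?_⟩
      simp [mem_uncoloredDarts, recolor_uncolored_iff, hq]
    · intro d
      simp only [mem_uncoloredDarts, recolor_uncolored_iff]
      tauto
  exact (Finset.card_lt_card hlt).not_ge (hc _)

end Defect

end PartialEdgeColoring

namespace PartialEdgeColoring

variable {V : Type*} [Fintype V] {G : SimpleGraph V} {c : PartialEdgeColoring G}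
  {p q x y : V} {a b : Fin 3}

/-- In the optimal colouring `c` the edge `pq` is uncoloured, `p` misses `a` and `q` misses `b`. -/
structure IsPivot (c : PartialEdgeColoring G) (p q : V) (a b : Fin 3) : Prop where
  opt : c.IsOptimal
  unc : c.Uncolored p q
  left : c.σ a p = p
  right : c.σ b q = q

namespace IsPivot

theorem symm (h : c.IsPivot p q a b) : c.IsPivot q p b a :=
  ⟨h.opt, h.unc.symm, h.right, h.left⟩

theorem right_ne (h : c.IsPivot p q a b) : c.σ a q ≠ q := h.opt.apply_ne h.unc h.left

theorem left_ne (h : c.IsPivot p q a b) : c.σ b p ≠ p := h.symm.right_ne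

theorem ne (h : c.IsPivot p q a b) : a ≠ b := fun hab => h.right_ne (hab ▸ h.right)

theorem kempeChain (h : c.IsPivot p q a b) : KempeChain (c.σ a) (c.σ b) q p := by
  by_contra hp
  have hu : (c.kempeSwap a b q).Uncolored p q := (c.kempeSwap_uncolored_iff).mpr h.unc
  refine (h.opt.kempeSwap a b q).apply_ne hu (a := a) ?_ ?_
  · rw [c.kempeSwap_apply_of_not_mem hp, h.left]
  · rw [c.kempeSwap_apply_of_mem .refl, Equiv.swap_apply_left, h.right]

theorem kempeChain_symm (h : c.IsPivot p q a b) (hx : KempeChain (c.σ a) (c.σ b) q x) :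
    KempeChain (c.σ b) (c.σ a) p x :=
  ((h.kempeChain.symm (c.invol a) (c.invol b)).trans hx).swap

theorem eq_right (h : c.IsPivot p q a b) (hx : KempeChain (c.σ a) (c.σ b) q x)
    (hb : c.σ b x = x) : x = q :=
  h.kempeChain.eq_of_right_fixed (c.invol a) (c.invol b) h.right h.left hx hb

theorem eq_left (h : c.IsPivot p q a b) (hx : KempeChain (c.σ a) (c.σ b) q x)
    (ha : c.σ a x = x) : x = p :=
  h.symm.eq_right (h.kempeChain_symm hx) ha

theorem shift (h : c.IsPivot p q a b) :
    (c.recolor h.unc h.left).IsPivot q (c.σ a q) b a where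
  opt := h.opt.recolor h.unc h.left
  unc := (c.recolor_uncolored_iff h.unc h.left).mpr (.inr ⟨h.right_ne, .inl ⟨rfl, rfl⟩⟩)
  left := by rw [c.recolor_apply_of_ne h.unc h.left h.ne.symm, h.right]
  right := c.recolor_apply_old h.unc h.left h.right_ne

theorem exists_rotation_altSeq (P : PartialEdgeColoring G → V → V → Prop)
    (step : ∀ (c : PartialEdgeColoring G) (p q : V) (a b : Fin 3) (h : c.IsPivot p q a b),
      P c p q → P (c.recolor h.unc h.left) q (c.σ a q)) (i : ℕ) :
    ∀ (c : PartialEdgeColoring G) (p q : V) (a b : Fin 3), c.IsPivot p q a b → P c p q →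
      (∀ j < i, altSeq (c.σ a) (c.σ b) q j ≠ p) →
      ∃ c' p' a' b', c'.IsPivot p' (altSeq (c.σ a) (c.σ b) q i) a' b' ∧
        P c' p' (altSeq (c.σ a) (c.σ b) q i) := by
  induction i with
  | zero => exact fun c p q a b h hP _ => ⟨c, p, a, b, h, hP⟩
  | succ i ih =>
    intro c p q a b h hP hi
    have inj := altSeq_injOn (c.invol a) (c.invol b) h.right h.kempeChain hi
    have h1 : altSeq (c.σ a) (c.σ b) q 1 = c.σ a q := altSeq_succ_even (by simp)
    set c' := c.recolor h.unc h.left with hc'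
    have key : ∀ j ≤ i, altSeq (c'.σ b) (c'.σ a) (c.σ a q) j =
        altSeq (c.σ a) (c.σ b) q (j + 1) := by
      intro j
      induction j with
      | zero => intro _; exact h1.symm
      | succ j ihj =>
        intro hj
        have ihj := ihj (by omega)
        by_cases hev : Even j
        · rw [altSeq_succ_even hev, ihj,
            altSeq_succ_odd (n := j + 1) (fun h' => Nat.even_add_one.mp h' hev), hc',
            c.recolor_apply_of_ne h.unc h.left h.ne.symm]
        · rw [altSeq_succ_odd hev, ihj, altSeq_succ_even (Nat.even_add_one.mpr hev), hc']
          have hq : altSeq (c.σ a) (c.σ b) q (j + 1) ≠ q :=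
            (inj (j + 1) 0 (by omega) (by omega)).symm
          have hj0 : j ≠ 0 := by rintro rfl; simp at hev
          have hw : altSeq (c.σ a) (c.σ b) q (j + 1) ≠ c.σ a q := by
            rw [← h1]; exact (inj (j + 1) 1 (by omega) (by omega)).symm
          exact c.recolor_apply_other h.unc h.left (hi _ (by omega)) hq hw a
    have := ih c' q (c.σ a q) b a h.shift (step c p q a b h hP) fun j hj => by
      rw [key j hj.le]
      exact (inj (j + 1) 0 (by omega) (by omega)).symm
    rwa [key i le_rfl] at this

/-- Rotating the uncoloured edge along its odd cycle: every vertex of the Kempe chain of `pq`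
becomes the end of the uncoloured edge, and any property preserved by single moves persists. -/
theorem exists_rotation (h : c.IsPivot p q a b) (hx : KempeChain (c.σ a) (c.σ b) q x)
    (P : PartialEdgeColoring G → V → V → Prop) (hP : P c p q)
    (step : ∀ (c : PartialEdgeColoring G) (p q : V) (a b : Fin 3) (h : c.IsPivot p q a b),
      P c p q → P (c.recolor h.unc h.left) q (c.σ a q)) :
    ∃ c' p' a' b', c'.IsPivot p' x a' b' ∧ P c' p' x := by
  obtain ⟨m, -, hlt, hst⟩ :=
    h.kempeChain.exists_altSeq_end (c.invol a) (c.invol b) h.right h.left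
  obtain ⟨j, hj, rfl⟩ := hx.exists_altSeq_eq_of_stationary (c.invol a) (c.invol b) h.right hst
  exact exists_rotation_altSeq P step j c p q a b h hP fun i hi => hlt i (by omega)

end IsPivot

section Subcubic

variable (hG : G.IsSubcubic)

include hG

theorem Uncolored.exists_missing (h : c.Uncolored p q) : ∃ a, c.σ a p = p := by
  by_contra! hne
  have hd := fun i j hij => c.disj i j p hij (hne i)
  rcases hG.eq_of_adj (c.adj 0 p (hne 0)) (c.adj 1 p (hne 1)) (c.adj 2 p (hne 2)) h.1
    (hd 0 1 (by decide)) (hd 0 2 (by decide)) (hd 1 2 (by decide)) with h1 | h1 | h1 <;>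
  exact h.2 _ h1.symm

theorem IsOptimal.exists_isPivot (hc : c.IsOptimal) (h : c.Uncolored p q) :
    ∃ a b, c.IsPivot p q a b := by
  obtain ⟨a, ha⟩ := h.exists_missing hG
  obtain ⟨b, hb⟩ := h.symm.exists_missing hG
  exact ⟨a, b, hc, h, ha, hb⟩

theorem IsOptimal.uncolored_unique (hc : c.IsOptimal) {v u w : V} (hu : c.Uncolored v u)
    (hw : c.Uncolored v w) : u = w := by
  by_contra hne
  obtain ⟨a, ha⟩ := hu.symm.exists_missing hG
  obtain ⟨b, hb⟩ := hw.symm.exists_missing hG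
  have hva := hc.apply_ne hu.symm ha
  have hvb := hc.apply_ne hw.symm hb
  have hfix : ∀ i, i ≠ a → c.σ i v = v := by
    intro i hi
    by_contra hvi
    rcases hG.eq_of_adj (c.adj a v hva) (c.adj i v hvi) hu.1 hw.1
      (c.disj a i v hi.symm hva) (hu.2 a) (hu.2 i) with h | h | h
    · exact hw.2 _ h.symm
    · exact hw.2 _ h.symm
    · exact hne h.symm
  obtain rfl : b = a := by by_contra hba; exact hvb (hfix b hba)
  obtain ⟨i, hi⟩ : ∃ i : Fin 3, i ≠ b := exists_ne b
  have h1 : c.IsPivot u v b i := ⟨hc, hu.symm, ha, hfix i hi⟩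
  have h2 : c.IsPivot w v b i := ⟨hc, hw.symm, hb, hfix i hi⟩
  exact hne (h2.eq_left h1.kempeChain ha)

/-- No other uncoloured edge meets the Kempe chain of an uncoloured edge. -/
theorem IsPivot.eq_of_uncolored (h : c.IsPivot p q a b)
    (hx : KempeChain (c.σ a) (c.σ b) q x) (hxy : c.Uncolored x y) :
    x = p ∧ y = q ∨ x = q ∧ y = p := by
  by_contra hne
  obtain ⟨c', p', a', b', h', hu, hn⟩ := h.exists_rotation hx
    (fun c p q => c.Uncolored x y ∧ ¬ (x = p ∧ y = q ∨ x = q ∧ y = p)) ⟨hxy, hne⟩ (by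
      rintro c p q a b h ⟨hu, hn⟩
      refine ⟨(c.recolor_uncolored_iff _ _).mpr (.inl ⟨hu, by tauto, by tauto⟩), ?_⟩
      rintro (⟨rfl, rfl⟩ | ⟨rfl, rfl⟩)
      · exact hu.2 a rfl
      · exact hu.symm.2 a rfl)
  exact hn (.inr ⟨rfl, h'.opt.uncolored_unique hG hu h'.unc.symm⟩)

/-- Kempe chains of distinct uncoloured edges are disjoint. -/
theorem IsPivot.eq_of_mem_of_mem {p' q' : V} {a' b' : Fin 3} (h : c.IsPivot p q a b)
    (h' : c.IsPivot p' q' a' b') (hx : KempeChain (c.σ a) (c.σ b) q x)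
    (hx' : KempeChain (c.σ a') (c.σ b') q' x) :
    p = p' ∧ q = q' ∨ p = q' ∧ q = p' := by
  by_contra hne
  obtain ⟨c₁, p₁, a₁, b₁, h₁, h₂, hx₂, hn⟩ := h.exists_rotation hx
    (fun c p q => c.IsPivot p' q' a' b' ∧ KempeChain (c.σ a') (c.σ b') q' x ∧
      ¬ (p = p' ∧ q = q' ∨ p = q' ∧ q = p')) ⟨h', hx', hne⟩ (by
      rintro c p q a b h ⟨h', hx', hn⟩
      have hp : ¬ KempeChain (c.σ a') (c.σ b') q' p := fun hp => by
        have := h'.eq_of_uncolored hG hp h.unc; tauto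
      have hq : ¬ KempeChain (c.σ a') (c.σ b') q' q := fun hq => by
        have := h'.eq_of_uncolored hG hq h.unc.symm; tauto
      have hagree : ∀ i, (i = a' ∨ i = b') → ∀ y, KempeChain (c.σ a') (c.σ b') q' y →
          (c.recolor h.unc h.left).σ i y = c.σ i y := by
        intro i hi y hy
        by_cases hia : i = a
        · subst hia
          refine c.recolor_apply_other _ _ (by rintro rfl; exact hp hy)
            (by rintro rfl; exact hq hy) ?_ _
          rintro rfl
          rcases hi with rfl | rfl
          · exact hq ((KempeChain.left_iff (c.invol _)).mp hy)
          · exact hq ((KempeChain.right_iff (c.invol _)).mp hy)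
        · exact c.recolor_apply_of_ne _ _ hia _
      refine ⟨⟨h.shift.opt, (c.recolor_uncolored_iff _ _).mpr
        (.inl ⟨h'.unc, by grind, by grind⟩), ?_, ?_⟩, ?_, ?_⟩
      · rw [hagree a' (.inl rfl) p' h'.kempeChain, h'.left]
      · rw [hagree b' (.inr rfl) q' .refl, h'.right]
      · have : ∀ y, KempeChain (c.σ a') (c.σ b') q' y →
            KempeChain ((c.recolor h.unc h.left).σ a') ((c.recolor h.unc h.left).σ b') q' y := by
          intro y hy
          induction hy with
          | refl => exact .refl
          | left hy ih => rw [← hagree a' (.inl rfl) _ hy]; exact ih.left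
          | right hy ih => rw [← hagree b' (.inr rfl) _ hy]; exact ih.right
        exact this x hx'
      · rintro (⟨rfl, -⟩ | ⟨rfl, -⟩)
        · exact hq h'.kempeChain
        · exact hq .refl)
  have := h₂.eq_of_uncolored hG hx₂ h₁.unc.symm
  tauto

end Subcubic

end PartialEdgeColoring

/-- A triangle whose contraction creates no multiple edges: vertices outside the triangle have
at most one neighbour in it. -/
structure SimpleGraph.IsContractibleTriangle {V : Type*} (G : SimpleGraph V) (s : Fin 3 → V) :
    Prop where
  inj : Function.Injective s
  adj : ∀ i j, i ≠ j → G.Adj (s i) (s j)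
  outer : ∀ x, x ∉ Set.range s → ∀ i j, G.Adj x (s i) → G.Adj x (s j) → i = j

theorem SimpleGraph.isContractibleTriangle {V : Type*} {G : SimpleGraph V} {p q w : V}
    (hpq : G.Adj p q) (hpw : G.Adj p w) (hqw : G.Adj q w)
    (h₁ : ∀ x, G.Adj p x → G.Adj q x → x = w) (h₂ : ∀ x, G.Adj p x → G.Adj w x → x = q)
    (h₃ : ∀ x, G.Adj q x → G.Adj w x → x = p) :
    G.IsContractibleTriangle ![p, q, w] where
  inj := by
    simp [Function.Injective, Fin.forall_fin_succ, hpq.ne, hpw.ne, hqw.ne, hpq.ne', hpw.ne',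
      hqw.ne']
  adj := by simp [Fin.forall_fin_succ, hpq, hpw, hqw, hpq.symm, hpw.symm, hqw.symm]
  outer := by
    intro x hx
    have hp : x ≠ p := fun h => hx ⟨0, h.symm⟩
    have hq : x ≠ q := fun h => hx ⟨1, h.symm⟩
    have hw : x ≠ w := fun h => hx ⟨2, h.symm⟩
    have h₁ : G.Adj x p → ¬ G.Adj x q := fun a b => hw (h₁ x a.symm b.symm)
    have h₂ : G.Adj x p → ¬ G.Adj x w := fun a b => hq (h₂ x a.symm b.symm)
    have h₃ : G.Adj x q → ¬ G.Adj x w := fun a b => hp (h₃ x a.symm b.symm)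
    simp [Fin.forall_fin_succ]
    tauto

/-- `f` identifies `B₃` with a connected component of `G`. -/
structure SimpleGraph.IsB3Component {V : Type*} (G : SimpleGraph V) (f : Fin 5 → V) : Prop where
  inj : Function.Injective f
  adj_iff : ∀ i j, G.Adj (f i) (f j) ↔ B3.Adj i j
  closed : ∀ i y, G.Adj (f i) y → y ∈ Set.range f

namespace PartialEdgeColoring

variable {V : Type*} [Fintype V] {G : SimpleGraph V} {c : PartialEdgeColoring G}
  {p q x y : V} {a b k : Fin 3}

variable (c) in
/-- `y` lies on a Kempe chain joining the ends of the uncoloured edge `pq`. -/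
def InChain (p q y : V) : Prop :=
  ∃ a b, c.IsPivot p q a b ∧ KempeChain (c.σ a) (c.σ b) q y

variable (c) in
/-- The total degree of the ends of uncoloured edges, each edge counted twice. -/
noncomputable def defectDegree : ℕ :=
  ∑ d ∈ c.uncoloredDarts, ((G.neighborSet d.1).ncard + (G.neighborSet d.2).ncard)

theorem InChain.symm (h : c.InChain p q y) : c.InChain q p y :=
  let ⟨a, b, h, hy⟩ := h
  ⟨b, a, h.symm, h.kempeChain_symm hy⟩

theorem two_le_ncard_of_apply_ne {i j : Fin 3} (hij : i ≠ j) (hi : c.σ i x ≠ x)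
    (hj : c.σ j x ≠ x) : 2 ≤ (G.neighborSet x).ncard :=
  G.two_le_ncard (c.adj i x hi) (c.adj j x hj) (c.disj i j x hij hi)

theorem three_le_ncard_of_apply_ne (hx : ∀ i, c.σ i x ≠ x) : 3 ≤ (G.neighborSet x).ncard :=
  G.three_le_ncard (c.adj 0 x (hx 0)) (c.adj 1 x (hx 1)) (c.adj 2 x (hx 2))
    (c.disj 0 1 x (by decide) (hx 0)) (c.disj 0 2 x (by decide) (hx 0))
    (c.disj 1 2 x (by decide) (hx 1))

theorem Uncolored.three_le_ncard {i j : Fin 3} (h : c.Uncolored p q) (hij : i ≠ j)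
    (hi : c.σ i p ≠ p) (hj : c.σ j p ≠ p) : 3 ≤ (G.neighborSet p).ncard :=
  G.three_le_ncard h.1 (c.adj i p hi) (c.adj j p hj) (h.2 i).symm (h.2 j).symm
    (c.disj i j p hij hi)

theorem IsPivot.two_le_ncard_left (h : c.IsPivot p q a b) : 2 ≤ (G.neighborSet p).ncard :=
  G.two_le_ncard h.unc.1 (c.adj b p h.left_ne) (h.unc.2 b).symm

theorem InChain.two_le_ncard (h : c.InChain p q y) : 2 ≤ (G.neighborSet y).ncard := by
  obtain ⟨a, b, h, hy⟩ := h
  by_cases ha : c.σ a y = y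
  · rw [h.eq_left hy ha]; exact h.two_le_ncard_left
  by_cases hb : c.σ b y = y
  · rw [h.eq_right hy hb]; exact h.symm.two_le_ncard_left
  exact two_le_ncard_of_apply_ne h.ne ha hb

section Subcubic

variable (hG : G.IsSubcubic)

include hG

theorem InChain.eq_of_uncolored (h : c.InChain p q x) (hxy : c.Uncolored x y) :
    x = p ∧ y = q ∨ x = q ∧ y = p :=
  let ⟨_, _, h, hx⟩ := h
  h.eq_of_uncolored hG hx hxy

theorem InChain.exists_apply_eq (h : c.InChain p q x) (hp : x ≠ p) (hq : x ≠ q)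
    (hxy : G.Adj x y) : ∃ i, c.σ i x = y := by
  by_contra! hy
  rcases h.eq_of_uncolored hG ⟨hxy, hy⟩ with ⟨rfl, -⟩ | ⟨rfl, -⟩
  · exact hp rfl
  · exact hq rfl

/-- If both ends of `pq` have degree three and `c` is extremal, so do all vertices of the chain. -/
theorem IsPivot.three_le_ncard_of_kempeChain (h : c.IsPivot p q a b)
    (hbest : ∀ c' : PartialEdgeColoring G, c'.IsOptimal → c.defectDegree ≤ c'.defectDegree)
    (hp : 3 ≤ (G.neighborSet p).ncard) (hq : 3 ≤ (G.neighborSet q).ncard)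
    (hx : KempeChain (c.σ a) (c.σ b) q x) : 3 ≤ (G.neighborSet x).ncard := by
  obtain ⟨c', p', a', b', h', hle⟩ := h.exists_rotation hx
    (fun c' p' q' => c'.defectDegree + 2 * ((G.neighborSet p).ncard + (G.neighborSet q).ncard) ≤
      c.defectDegree + 2 * ((G.neighborSet p').ncard + (G.neighborSet q').ncard)) le_rfl (by
      intro c' p' q' a b h hle
      have := c'.recolor_sum_le h.unc h.left
        fun d => (G.neighborSet d.1).ncard + (G.neighborSet d.2).ncard
      simp only [defectDegree] at *
      omega)
  have := hbest c' h'.opt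
  have := hG p'
  omega

theorem IsPivot.exists_weight_of_apply_ne (h : c.IsPivot p q a b)
    (hT : ∀ s, ¬ G.IsContractibleTriangle s)
    (hbest : ∀ c' : PartialEdgeColoring G, c'.IsOptimal → c.defectDegree ≤ c'.defectDegree)
    (hka : k ≠ a) (hkb : k ≠ b) (hk : ∀ i, i = a ∨ i = b ∨ i = k)
    (hp : c.σ k p ≠ p) (hq : c.σ k q ≠ q) :
    ∃ F : Finset V, (∀ y ∈ F, c.InChain p q y) ∧ 15 ≤ ∑ y ∈ F, (G.neighborSet y).ncard := by
  classical
  have hdeg : ∀ x, KempeChain (c.σ a) (c.σ b) q x → 3 ≤ (G.neighborSet x).ncard := fun x hx =>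
    h.three_le_ncard_of_kempeChain hG hbest
      (h.unc.three_le_ncard hkb hp h.left_ne) (h.unc.symm.three_le_ncard hka hq h.right_ne) hx
  have hw : KempeChain (c.σ a) (c.σ b) q (c.σ a q) := KempeChain.refl.left
  have hwq := h.right_ne
  have hwp := h.unc.symm.2 a
  have hw'q := h.unc.2 b
  have hw'p := h.left_ne
  have hpq := h.unc.1.ne
  have hab := h.ne
  by_cases hww : c.σ a q = c.σ b p
  · exfalso
    have hnp := fun x => hG.eq_of_adj (d := x) h.unc.1 (c.adj b p h.left_ne) (c.adj k p hp)
    have hnq := fun x => hG.eq_of_adj (d := x) h.unc.symm.1 (c.adj a q h.right_ne) (c.adj k q hq)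
    have hnw := fun x hx => InChain.exists_apply_eq hG (y := x) ⟨a, b, h, hw⟩ hwp hwq hx
    have hkp := h.unc.2 k
    have hkq := h.unc.symm.2 k
    have hkpb := c.disj k b p hkb hp
    have hkqa := c.disj k a q hka hq
    have ia := c.invol a
    have ib := c.invol b
    have ik := c.invol k
    unfold Function.Involutive at ia ib ik
    refine hT _ (SimpleGraph.isContractibleTriangle (w := c.σ a q) h.unc.1 (hww ▸ c.adj b p h.left_ne)
      (c.adj a q h.right_ne) ?_ ?_ ?_)
    · intro x hx hx'
      have := hnp x hx
      have := hnq x hx'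
      grind
    · intro x hx hx'
      have := hnp x hx
      have := hx'.ne
      obtain ⟨i, hi⟩ := hnw x hx'
      rcases hk i with rfl | rfl | rfl <;> grind
    · intro x hx hx'
      have := hnq x hx
      have := hx'.ne
      obtain ⟨i, hi⟩ := hnw x hx'
      rcases hk i with rfl | rfl | rfl <;> grind
  · have hzw : c.σ b (c.σ a q) ≠ c.σ a q := fun e => hwq (h.eq_right hw e)
    have hzq : c.σ b (c.σ a q) ≠ q := fun e => hwq (by rw [← c.invol b (c.σ a q), e, h.right])
    have hzp : c.σ b (c.σ a q) ≠ p := fun e => hww (by rw [← e, c.invol b])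
    have hzw' : c.σ b (c.σ a q) ≠ c.σ b p := fun e => hwp ((c.invol b).injective e)
    refine ⟨{p, q, c.σ a q, c.σ b p, c.σ b (c.σ a q)}, ?_, ?_⟩
    · intro y hy
      refine ⟨a, b, h, ?_⟩
      simp only [Finset.mem_insert, Finset.mem_singleton] at hy
      rcases hy with rfl | rfl | rfl | rfl | rfl
      exacts [h.kempeChain, .refl, hw, h.kempeChain.right, hw.right]
    · have h1 := hdeg _ h.kempeChain
      have h2 := hdeg _ .refl
      have h3 := hdeg _ hw
      have h4 := hdeg _ h.kempeChain.right
      have h5 := hdeg _ hw.right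
      rw [Finset.sum_insert (by simp; grind), Finset.sum_insert (by simp; grind),
        Finset.sum_insert (by simp; grind), Finset.sum_insert (by simp; grind),
        Finset.sum_singleton]
      omega

end Subcubic

end PartialEdgeColoring

theorem SimpleGraph.isB3Component {V : Type*} {G : SimpleGraph V} {u w y z v : V}
    (huv : G.Adj u v) (huy : G.Adj u y) (huz : G.Adj u z) (hwv : G.Adj w v) (hwy : G.Adj w y)
    (hwz : G.Adj w z) (hyz : G.Adj y z) (hu : ∀ x, G.Adj u x → x = v ∨ x = y ∨ x = z)
    (hw : ∀ x, G.Adj w x → x = v ∨ x = y ∨ x = z) (hy : ∀ x, G.Adj y x → x = u ∨ x = w ∨ x = z)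
    (hz : ∀ x, G.Adj z x → x = u ∨ x = w ∨ x = y) (hv : ∀ x, G.Adj v x → x = u ∨ x = w)
    (huw : u ≠ w) (hvy : v ≠ y) (hvz : v ≠ z) : G.IsB3Component ![u, w, y, z, v] where
  inj := by
    have := huv.ne; have := huy.ne; have := huz.ne; have := hwv.ne; have := hwy.ne
    have := hwz.ne; have := hyz.ne
    simp [Function.Injective, Fin.forall_fin_succ]
    grind
  adj_iff := by
    have nuw : ¬ G.Adj u w := fun h => by
      rcases hu w h with rfl | rfl | rfl
      exacts [hwv.ne rfl, hwy.ne rfl, hwz.ne rfl]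
    have nvy : ¬ G.Adj v y := fun h => by
      rcases hv y h with rfl | rfl
      exacts [huy.ne rfl, hwy.ne rfl]
    have nvz : ¬ G.Adj v z := fun h => by
      rcases hv z h with rfl | rfl
      exacts [huz.ne rfl, hwz.ne rfl]
    have nyv : ¬ G.Adj y v := fun h => nvy h.symm
    have nzv : ¬ G.Adj z v := fun h => nvz h.symm
    simp [Fin.forall_fin_succ, B3, *, G.adj_comm]
  closed := by
    simp [Fin.forall_fin_succ]
    grind

namespace PartialEdgeColoring

variable {V : Type*} [Fintype V] {G : SimpleGraph V} {c : PartialEdgeColoring G}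
  {p q u v x y : V} {a b k : Fin 3}

theorem IsPivot.eq_of_adj_of_apply_eq (h : c.IsPivot u v a b) (hG : G.IsSubcubic)
    (hk : ∀ i, i = a ∨ i = b ∨ i = k) (hv : c.σ k v = v) (hx : G.Adj v x) :
    x = u ∨ x = c.σ a v := by
  by_cases hxv : ∀ i, c.σ i v ≠ x
  · exact .inl (h.opt.uncolored_unique hG ⟨hx, hxv⟩ h.unc.symm)
  · push Not at hxv
    obtain ⟨i, rfl⟩ := hxv
    rcases hk i with rfl | rfl | rfl
    · exact .inr rfl
    · exact absurd h.right hx.ne'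
    · exact absurd hv hx.ne'

theorem IsPivot.apply_ne_apply (hG : G.IsSubcubic) (hT : ∀ s, ¬ G.IsContractibleTriangle s)
    (h : c.IsPivot u v a b) (h' : c.IsPivot u v a k) (hbk : b ≠ k)
    (hk : ∀ i, i = a ∨ i = b ∨ i = k) : c.σ a v ≠ c.σ b u := by
  intro hw
  have hwu := h.unc.symm.2 a
  have hbu := h.left_ne
  have hku := h'.left_ne
  have hbv := h.unc.2 b
  have hkv := h.unc.2 k
  have hbku := c.disj b k u hbk hbu
  have ia := c.invol a
  have ib := c.invol b
  have ik := c.invol k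
  unfold Function.Involutive at ia ib ik
  have hnu := fun x => hG.eq_of_adj (d := x) h.unc.1 (c.adj b u hbu) (c.adj k u hku)
  have hnv := fun x => h.eq_of_adj_of_apply_eq (x := x) hG hk h'.right
  have hnw := fun x hx => InChain.exists_apply_eq hG (y := x) ⟨a, b, h, KempeChain.refl.left⟩ hwu
    h.right_ne hx
  refine hT _ (SimpleGraph.isContractibleTriangle (w := c.σ a v) h.unc.1 (hw ▸ c.adj b u hbu)
    (c.adj a v h.right_ne) ?_ ?_ ?_)
  · intro x hx hx'
    have := hnv x hx'
    have := hx.ne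
    grind
  · intro x hx hx'
    have := hnu x hx
    obtain ⟨i, hi⟩ := hnw x hx'
    have := hx'.ne
    have := hx.ne
    rcases hk i with rfl | rfl | rfl <;> grind
  · intro x hx hx'
    have := hnv x hx
    have := hx'.ne
    grind

theorem IsPivot.exists_weight_or_isB3Component (hG : G.IsSubcubic)
    (hT : ∀ s, ¬ G.IsContractibleTriangle s)
    (h : c.IsPivot u v a b) (h' : c.IsPivot u v a k) (hbk : b ≠ k)
    (hk : ∀ i, i = a ∨ i = b ∨ i = k) :
    (∃ F : Finset V, (∀ y ∈ F, c.InChain u v y) ∧ 15 ≤ ∑ y ∈ F, (G.neighborSet y).ncard) ∨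
      ∃ f, G.IsB3Component f ∧ ∀ i, c.InChain u v (f i) := by
  classical
  have hwb := h.apply_ne_apply hG hT h' hbk hk
  have hwk := h'.apply_ne_apply hG hT h hbk.symm
    fun i => by have := hk i; tauto
  have hwu := h.unc.symm.2 a
  have hwv := h.right_ne
  have hbu := h.left_ne
  have hku := h'.left_ne
  have hbv := h.unc.2 b
  have hkv := h.unc.2 k
  have huv := h.unc.1.ne
  have hvb := h.right
  have hvk := h'.right
  have hua := h.left
  have hbku := c.disj b k u hbk hbu
  have hab := h.ne
  have hak := h'.ne
  have ia := c.invol a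
  have ib := c.invol b
  have ik := c.invol k
  unfold Function.Involutive at ia ib ik
  set w := c.σ a v with hwdef
  have mwb : KempeChain (c.σ a) (c.σ b) v w := KempeChain.refl.left
  have mwk : KempeChain (c.σ a) (c.σ k) v w := KempeChain.refl.left
  have hzb : c.σ b w ≠ w := fun e => hwv (h.eq_right mwb e)
  have hzk : c.σ k w ≠ w := fun e => hwv (h'.eq_right mwk e)
  have hzbk := c.disj b k w hbk hzb
  have hzbv : c.σ b w ≠ v := by grind
  have hzkv : c.σ k w ≠ v := by grind
  have hzbu : c.σ b w ≠ u := by grind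
  have hzku : c.σ k w ≠ u := by grind
  have hzby : c.σ b w ≠ c.σ b u := by grind
  have hzky : c.σ k w ≠ c.σ k u := by grind
  have cu : c.InChain u v u := ⟨a, b, h, h.kempeChain⟩
  have cv : c.InChain u v v := ⟨a, b, h, .refl⟩
  have cw : c.InChain u v w := ⟨a, b, h, mwb⟩
  have cyb : c.InChain u v (c.σ b u) := ⟨a, b, h, h.kempeChain.right⟩
  have cyk : c.InChain u v (c.σ k u) := ⟨a, k, h', h'.kempeChain.right⟩
  have czb : c.InChain u v (c.σ b w) := ⟨a, b, h, mwb.right⟩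
  have czk : c.InChain u v (c.σ k w) := ⟨a, k, h', mwk.right⟩
  have dv := cv.two_le_ncard
  have dyb := cyb.two_le_ncard
  have dyk := cyk.two_le_ncard
  have dzb := czb.two_le_ncard
  have dzk := czk.two_le_ncard
  have du : 3 ≤ (G.neighborSet u).ncard := h.unc.three_le_ncard hbk hbu hku
  have dw : 3 ≤ (G.neighborSet w).ncard := three_le_ncard_of_apply_ne (c := c) fun i => by
    rcases hk i with rfl | rfl | rfl <;> grind
  have hayb : c.σ a (c.σ b u) ≠ c.σ b u := fun e => hbu (h.eq_left h.kempeChain.right e)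
  have hayk : c.σ a (c.σ k u) ≠ c.σ k u := fun e => hku (h'.eq_left h'.kempeChain.right e)
  by_cases e₁ : c.σ b w = c.σ k u <;> by_cases e₂ : c.σ k w = c.σ b u
  · by_cases ht : c.σ a (c.σ b u) = c.σ k u
    · right
      refine ⟨![u, w, c.σ b u, c.σ k u, v], SimpleGraph.isB3Component h.unc.1 (c.adj b u hbu)
        (c.adj k u hku) (c.adj a v hwv).symm (e₂ ▸ c.adj k w hzk) (e₁ ▸ c.adj b w hzb)
        (ht ▸ c.adj a _ hayb) (fun x hx => hG.eq_of_adj h.unc.1 (c.adj b u hbu) (c.adj k u hku)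
          hx hbv.symm hkv.symm hbku) (fun x hx => ?_) (fun x hx => ?_) (fun x hx => ?_)
        (fun x hx => h.eq_of_adj_of_apply_eq hG hk hvk hx) hwu.symm hbv.symm hkv.symm, ?_⟩
      · obtain ⟨i, hi⟩ := cw.exists_apply_eq hG hwu hwv hx
        rcases hk i with rfl | rfl | rfl <;> grind
      · obtain ⟨i, hi⟩ := cyb.exists_apply_eq hG hbu hbv hx
        rcases hk i with rfl | rfl | rfl <;> grind
      · obtain ⟨i, hi⟩ := cyk.exists_apply_eq hG hku hkv hx
        rcases hk i with rfl | rfl | rfl <;> grind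
      · simp [Fin.forall_fin_succ, cu, cv, cw, cyb, cyk]
    · left
      have := three_le_ncard_of_apply_ne (c := c) (x := c.σ b u) fun i => by
        rcases hk i with rfl | rfl | rfl <;> grind
      have := three_le_ncard_of_apply_ne (c := c) (x := c.σ k u) fun i => by
        rcases hk i with rfl | rfl | rfl <;> grind
      have ct : c.InChain u v (c.σ a (c.σ b u)) := ⟨a, b, h, h.kempeChain.right.left⟩
      have := ct.two_le_ncard
      refine ⟨[v, u, w, c.σ b u, c.σ k u, c.σ a (c.σ b u)].toFinset, by simp; grind, ?_⟩
      rw [List.sum_toFinset _ (by simp; grind)]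
      simp only [List.map_cons, List.map_nil, List.sum_cons, List.sum_nil]
      omega
  · left
    have := three_le_ncard_of_apply_ne (c := c) (x := c.σ k u) fun i => by
      rcases hk i with rfl | rfl | rfl <;> grind
    refine ⟨[v, u, w, c.σ b u, c.σ k u, c.σ k w].toFinset, by simp; grind, ?_⟩
    rw [List.sum_toFinset _ (by simp; grind)]
    simp only [List.map_cons, List.map_nil, List.sum_cons, List.sum_nil]
    omega
  · left
    have := three_le_ncard_of_apply_ne (c := c) (x := c.σ b u) fun i => by
      rcases hk i with rfl | rfl | rfl <;> grind
    refine ⟨[v, u, w, c.σ b u, c.σ k u, c.σ b w].toFinset, by simp; grind, ?_⟩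
    rw [List.sum_toFinset _ (by simp; grind)]
    simp only [List.map_cons, List.map_nil, List.sum_cons, List.sum_nil]
    omega
  · left
    refine ⟨[v, u, w, c.σ b u, c.σ k u, c.σ b w, c.σ k w].toFinset, by simp; grind, ?_⟩
    rw [List.sum_toFinset _ (by simp; grind)]
    simp only [List.map_cons, List.map_nil, List.sum_cons, List.sum_nil]
    omega

end PartialEdgeColoring

theorem SimpleGraph.IsB3Component.mem_range {V : Type*} {G : SimpleGraph V} {f : Fin 5 → V}
    (hf : G.IsB3Component f) {i : Fin 5} {x : V} (h : G.Reachable (f i) x) : x ∈ Set.range f := by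
  rw [SimpleGraph.reachable_iff_reflTransGen] at h
  induction h with
  | refl => exact ⟨i, rfl⟩
  | tail _ hxy ih =>
    obtain ⟨j, rfl⟩ := ih
    exact hf.closed j _ hxy

theorem SimpleGraph.IsB3Component.nonempty_iso {V : Type*} {G : SimpleGraph V} {f : Fin 5 → V}
    (hf : G.IsB3Component f) (hG : G.Connected) : Nonempty (G ≃g B3) :=
  ⟨(RelIso.symm ⟨Equiv.ofBijective f ⟨hf.inj, fun x => hf.mem_range (hG (f 0) x)⟩,
    hf.adj_iff _ _⟩ : G ≃g B3)⟩

theorem SimpleGraph.IsB3Component.fourteen_le_sum_ncard {V : Type*} [Fintype V]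
    {G : SimpleGraph V} {f : Fin 5 → V} (hf : G.IsB3Component f) :
    14 ≤ ∑ x, (G.neighborSet x).ncard := by
  classical
  have hadj : ∀ i j, B3.Adj i j → G.Adj (f i) (f j) := fun i j => (hf.adj_iff i j).mpr
  have hne : ∀ i j, i ≠ j → f i ≠ f j := fun i j hij e => hij (hf.inj e)
  have h0 : 3 ≤ (G.neighborSet (f 0)).ncard := G.three_le_ncard (hadj 0 2 (by simp [B3]))
    (hadj 0 3 (by simp [B3])) (hadj 0 4 (by simp [B3])) (hne _ _ (by decide))
    (hne _ _ (by decide)) (hne _ _ (by decide))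
  have h1 : 3 ≤ (G.neighborSet (f 1)).ncard := G.three_le_ncard (hadj 1 2 (by simp [B3]))
    (hadj 1 3 (by simp [B3])) (hadj 1 4 (by simp [B3])) (hne _ _ (by decide))
    (hne _ _ (by decide)) (hne _ _ (by decide))
  have h2 : 3 ≤ (G.neighborSet (f 2)).ncard := G.three_le_ncard (hadj 2 0 (by simp [B3]))
    (hadj 2 1 (by simp [B3])) (hadj 2 3 (by simp [B3])) (hne _ _ (by decide))
    (hne _ _ (by decide)) (hne _ _ (by decide))
  have h3 : 3 ≤ (G.neighborSet (f 3)).ncard := G.three_le_ncard (hadj 3 0 (by simp [B3]))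
    (hadj 3 1 (by simp [B3])) (hadj 3 2 (by simp [B3])) (hne _ _ (by decide))
    (hne _ _ (by decide)) (hne _ _ (by decide))
  have h4 : 2 ≤ (G.neighborSet (f 4)).ncard := G.two_le_ncard (hadj 4 0 (by simp [B3]))
    (hadj 4 1 (by simp [B3])) (hne _ _ (by decide))
  have h5 := Finset.sum_le_sum_of_subset (f := fun x => (G.neighborSet x).ncard)
    (Finset.subset_univ (Finset.univ.image f))
  rw [Finset.sum_image fun _ _ _ _ e => hf.inj e, Fin.sum_univ_five] at h5
  omega

namespace PartialEdgeColoring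

variable {V : Type*} [Fintype V] {G : SimpleGraph V} {c : PartialEdgeColoring G} {p q x y : V}

instance : Nonempty (PartialEdgeColoring G) :=
  ⟨⟨fun _ x => x, fun _ _ => rfl, fun _ _ h => absurd rfl h, fun _ _ _ _ h => absurd rfl h⟩⟩

variable (G) in
theorem exists_extremal : ∃ c : PartialEdgeColoring G, c.IsOptimal ∧
    ∀ c' : PartialEdgeColoring G, c'.IsOptimal → c.defectDegree ≤ c'.defectDegree := by
  have hne : {c : PartialEdgeColoring G | c.IsOptimal}.Nonempty :=
    ⟨Function.argmin fun c : PartialEdgeColoring G => c.uncoloredDarts.card,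
      fun c' => Function.argmin_le (fun c : PartialEdgeColoring G => c.uncoloredDarts.card) c'⟩
  exact ⟨_, Function.argminOn_mem defectDegree _ hne, fun c' hc' => Function.argminOn_le _ _ hc'⟩

section Subcubic

variable (hG : G.IsSubcubic)

include hG

theorem InChain.eq_of_inChain {p' q' : V} (h : c.InChain p q x) (h' : c.InChain p' q' x) :
    p = p' ∧ q = q' ∨ p = q' ∧ q = p' :=
  let ⟨_, _, h, hx⟩ := h
  let ⟨_, _, h', hx'⟩ := h'
  h.eq_of_mem_of_mem hG h' hx hx'

theorem Uncolored.exists_weight_or_isB3Component (hT : ∀ s, ¬ G.IsContractibleTriangle s)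
    (hc : c.IsOptimal)
    (hbest : ∀ c' : PartialEdgeColoring G, c'.IsOptimal → c.defectDegree ≤ c'.defectDegree)
    (h : c.Uncolored p q) :
    (∃ F : Finset V, (∀ y ∈ F, c.InChain p q y) ∧ 15 ≤ ∑ y ∈ F, (G.neighborSet y).ncard) ∨
      ∃ f, G.IsB3Component f ∧ ∀ i, c.InChain p q (f i) := by
  obtain ⟨a, b, h⟩ := hc.exists_isPivot hG h
  obtain ⟨k, hka, hkb, hk⟩ : ∃ k : Fin 3, k ≠ a ∧ k ≠ b ∧ ∀ i, i = a ∨ i = b ∨ i = k := by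
    have hab := h.ne
    clear h
    revert a b
    decide
  by_cases hq : c.σ k q = q
  · exact h.exists_weight_or_isB3Component hG hT ⟨hc, h.unc, h.left, hq⟩ hkb.symm hk
  by_cases hp : c.σ k p = p
  · have := h.symm.exists_weight_or_isB3Component hG hT ⟨hc, h.unc.symm, h.right, hp⟩ hka.symm
      fun i => by have := hk i; tauto
    exact this.imp (fun ⟨F, hF, h15⟩ => ⟨F, fun y hy => (hF y hy).symm, h15⟩)
      fun ⟨f, hf, hfc⟩ => ⟨f, hf, fun i => (hfc i).symm⟩
  · exact .inl (h.exists_weight_of_apply_ne hG hT hbest hka hkb hk hp hq)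

theorem card_uncoloredDarts_le_of_weights
    (hF : ∀ p q, c.Uncolored p q →
      ∃ F : Finset V, (∀ y ∈ F, c.InChain p q y) ∧ 15 ≤ ∑ y ∈ F, (G.neighborSet y).ncard) :
    15 * c.uncoloredDarts.card ≤ 2 * ∑ x, (G.neighborSet x).ncard := by
  classical
  choose! F hF h15 using hF
  calc 15 * c.uncoloredDarts.card = ∑ d ∈ c.uncoloredDarts, 15 := by simp [mul_comm]
    _ ≤ ∑ d ∈ c.uncoloredDarts, ∑ y ∈ F d.1 d.2, (G.neighborSet y).ncard :=
      Finset.sum_le_sum fun d hd => h15 _ _ (c.mem_uncoloredDarts.mp hd)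
    _ = ∑ y, ∑ d ∈ c.uncoloredDarts with y ∈ F d.1 d.2, (G.neighborSet y).ncard :=
      Finset.sum_comm' (by simp)
    _ ≤ ∑ y, 2 * (G.neighborSet y).ncard := Finset.sum_le_sum fun y _ => by
      rw [Finset.sum_const, smul_eq_mul]
      refine Nat.mul_le_mul_right _ ?_
      rcases Finset.eq_empty_or_nonempty {d ∈ c.uncoloredDarts | y ∈ F d.1 d.2} with h | ⟨d, hd⟩
      · simp [h]
      · refine (Finset.card_le_card (t := {d, d.swap}) fun e he => ?_).trans Finset.card_le_two
        simp only [Finset.mem_filter, mem_uncoloredDarts] at hd he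
        have := (hF _ _ he.1 y he.2).eq_of_inChain hG (hF _ _ hd.1 y hd.2)
        simpa [Prod.ext_iff] using this
    _ = 2 * ∑ y, (G.neighborSet y).ncard := (Finset.mul_sum ..).symm

end Subcubic

end PartialEdgeColoring

/-- `G` has a partial colouring leaving at most `2/15` of its edges uncoloured, or it is `B₃` up to
isolated vertices. -/
def SimpleGraph.HasSmallDefect {V : Type*} [Fintype V] (G : SimpleGraph V) : Prop :=
  ∃ c : PartialEdgeColoring G,
    15 * c.uncoloredDarts.card ≤ 2 * ∑ x, (G.neighborSet x).ncard ∨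
      c.uncoloredDarts.card ≤ 2 ∧ 14 ≤ ∑ x, (G.neighborSet x).ncard ∧
        (G.Connected → Nonempty (G ≃g B3))

/-- Any two non-isolated vertices are joined by a walk. -/
def SimpleGraph.IsConnectedOnEdges {V : Type*} (G : SimpleGraph V) : Prop :=
  ∀ ⦃x x' y y' : V⦄, G.Adj x x' → G.Adj y y' → G.Reachable x y

theorem SimpleGraph.hasSmallDefect_of_forall_not_isContractibleTriangle {V : Type*} [Fintype V]
    {G : SimpleGraph V} (hG : G.IsSubcubic) (hconn : G.IsConnectedOnEdges)
    (hT : ∀ s, ¬ G.IsContractibleTriangle s) : G.HasSmallDefect := by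
  classical
  obtain ⟨c, hc, hbest⟩ := PartialEdgeColoring.exists_extremal G
  refine ⟨c, ?_⟩
  by_cases hB : ∃ p q f, G.IsB3Component f ∧ ∀ i, c.InChain p q (f i)
  · obtain ⟨p, q, f, hf, hfc⟩ := hB
    refine .inr ⟨?_, hf.fourteen_le_sum_ncard, hf.nonempty_iso⟩
    refine (Finset.card_le_card (t := {(p, q), (q, p)}) fun d hd => ?_).trans Finset.card_le_two
    rw [c.mem_uncoloredDarts] at hd
    obtain ⟨i, hi⟩ := hf.mem_range
      (hconn ((hf.adj_iff 0 2).mpr (by simp [B3])) hd.1)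
    have := (hi ▸ hfc i).eq_of_uncolored hG hd
    simpa [Prod.ext_iff] using this
  · refine .inl (PartialEdgeColoring.card_uncoloredDarts_le_of_weights hG fun p q h => ?_)
    refine (h.exists_weight_or_isB3Component hG hT hc hbest).resolve_right ?_
    rintro ⟨f, hf⟩
    exact hB ⟨p, q, f, hf⟩

theorem ne_add_fin_three (i : Fin 3) : i ≠ i + 1 ∧ i ≠ i + 2 ∧ i + 1 ≠ i + 2 := by
  revert i; decide

namespace SimpleGraph

variable {V : Type*} {G : SimpleGraph V} {s : Fin 3 → V} {r x y z t : V} {i j : Fin 3}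

open scoped Classical in
/-- The map contracting the set `S` to the vertex `r`. -/
noncomputable def collapse (S : Set V) (r x : V) : V := if x ∈ S then r else x

theorem collapse_of_mem {S : Set V} (h : x ∈ S) : collapse S r x = r := if_pos h

theorem collapse_of_notMem {S : Set V} (h : x ∉ S) : collapse S r x = x := if_neg h

variable (G) in
/-- The graph obtained by contracting `S` to `r`, the other vertices of `S` becoming isolated. -/
def contract (S : Set V) (r : V) : SimpleGraph V where
  Adj z t := z ≠ t ∧ ∃ x y, collapse S r x = z ∧ collapse S r y = t ∧ G.Adj x y
  symm := ⟨fun _ _ ⟨hne, x, y, hx, hy, h⟩ => ⟨hne.symm, y, x, hy, hx, h.symm⟩⟩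
  loopless := ⟨fun _ h => h.1 rfl⟩

section Contract

variable {S : Set V}

theorem contract_adj_of_adj (h : G.Adj x y) (hne : collapse S r x ≠ collapse S r y) :
    (G.contract S r).Adj (collapse S r x) (collapse S r y) := ⟨hne, x, y, rfl, rfl, h⟩

theorem eq_of_contract_adj (h : (G.contract S r).Adj z t) (hz : z ∈ S) : z = r := by
  obtain ⟨-, x, -, rfl, -, -⟩ := h
  unfold collapse at *
  grind

theorem adj_of_contract_adj (hr : r ∈ S) (h : (G.contract S r).Adj z t) (hz : z ∉ S)
    (ht : t ∉ S) : G.Adj z t := by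
  obtain ⟨-, x, y, rfl, rfl, h⟩ := h
  unfold collapse at *
  grind

theorem exists_mem_adj_of_contract_adj (hr : r ∈ S) (h : (G.contract S r).Adj r t) :
    t ∉ S ∧ ∃ x ∈ S, G.Adj x t := by
  obtain ⟨hne, x, y, hx, rfl, h⟩ := h
  unfold collapse at *
  grind

theorem IsConnectedOnEdges.contract (hG : G.IsConnectedOnEdges) (S : Set V) (r : V) :
    (G.contract S r).IsConnectedOnEdges := by
  have key : ∀ x y, G.Reachable x y →
      (G.contract S r).Reachable (collapse S r x) (collapse S r y) := by
    intro x y h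
    rw [SimpleGraph.reachable_iff_reflTransGen] at h
    induction h with
    | refl => exact .rfl
    | @tail a b _ hab ih =>
      by_cases hne : collapse S r a = collapse S r b
      · exact hne ▸ ih
      · exact ih.trans (contract_adj_of_adj hab hne).reachable
  rintro _ _ _ _ ⟨-, x, x', rfl, -, hx⟩ ⟨-, y, y', rfl, -, hy⟩
  exact key x y (hG hx hy)

theorem ncard_contract_neighborSet_le [Finite V] (hr : r ∈ S) (hx : x ∉ S) :
    ((G.contract S r).neighborSet x).ncard ≤ (G.neighborSet x).ncard := by
  refine le_trans (Set.ncard_le_ncard (t := collapse S r '' G.neighborSet x) ?_)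
    (Set.ncard_image_le (Set.toFinite _))
  rintro _ ⟨-, x', y, hx', rfl, h⟩
  refine ⟨y, ?_, rfl⟩
  obtain rfl : x' = x := by unfold collapse at hx'; grind
  exact h

end Contract

namespace IsContractibleTriangle

theorem comp_perm (hs : G.IsContractibleTriangle s) (β : Equiv.Perm (Fin 3)) :
    G.IsContractibleTriangle (s ∘ β) where
  inj := hs.inj.comp β.injective
  adj i j h := hs.adj _ _ (β.injective.ne h)
  outer x hx i j hi hj := β.injective (hs.outer x (by rwa [β.surjective.range_comp] at hx) _ _ hi hj)

theorem outer_unique [Finite V] (hs : G.IsContractibleTriangle s) (hG : G.IsSubcubic)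
    (hx : x ∉ Set.range s) (hy : y ∉ Set.range s) (hix : G.Adj (s i) x) (hiy : G.Adj (s i) y) :
    x = y := by
  obtain ⟨h1, h2, h3⟩ := ne_add_fin_three i
  rcases hG.eq_of_adj (hs.adj _ _ h1) (hs.adj _ _ h2) hix hiy (hs.inj.ne h3)
    (fun e => hx ⟨_, e⟩) (fun e => hx ⟨_, e⟩) with e | e | e
  · exact absurd ⟨_, e.symm⟩ hy
  · exact absurd ⟨_, e.symm⟩ hy
  · exact e.symm

theorem isSubcubic_contract [Finite V] (hs : G.IsContractibleTriangle s) (hG : G.IsSubcubic)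
    (hr : r ∈ Set.range s) : (G.contract (Set.range s) r).IsSubcubic := by
  intro z
  by_cases hz : z ∈ Set.range s
  · have hmem : ∀ t ∈ (G.contract (Set.range s) r).neighborSet z,
        t ∉ Set.range s ∧ ∃ i, G.Adj (s i) t := by
      intro t ht
      obtain rfl := eq_of_contract_adj ht hz
      obtain ⟨h, _, ⟨i, rfl⟩, hi⟩ := exists_mem_adj_of_contract_adj hr ht
      exact ⟨h, i, hi⟩
    choose! hout f hf using hmem
    have := Set.ncard_le_ncard_of_injOn (t := Set.univ) f (fun _ _ => Set.mem_univ _)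
      fun t ht t' ht' e => hs.outer_unique hG (hout t ht) (hout t' ht') (hf t ht)
        (e ▸ hf t' ht')
    simpa [Set.ncard_univ] using this
  · exact (ncard_contract_neighborSet_le hr hz).trans (hG z)

theorem sum_ncard_contract_add_three_le [Fintype V] (hs : G.IsContractibleTriangle s)
    (hG : G.IsSubcubic) (hr : r ∈ Set.range s) :
    ∑ x, ((G.contract (Set.range s) r).neighborSet x).ncard + 3 ≤
      ∑ x, (G.neighborSet x).ncard := by
  classical
  set T : Finset V := Finset.univ.image s with hT
  have hmem : ∀ x, x ∈ T ↔ x ∈ Set.range s := by simp [hT]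
  rw [← Finset.sum_add_sum_compl T, ← Finset.sum_add_sum_compl T fun x => (G.neighborSet x).ncard]
  have h1 : ∑ x ∈ Tᶜ, ((G.contract (Set.range s) r).neighborSet x).ncard ≤
      ∑ x ∈ Tᶜ, (G.neighborSet x).ncard := Finset.sum_le_sum fun x hx =>
    ncard_contract_neighborSet_le hr (by rwa [Finset.mem_compl, hmem] at hx)
  have h2 : ∑ x ∈ T, ((G.contract (Set.range s) r).neighborSet x).ncard ≤ 3 := by
    rw [Finset.sum_eq_single r]
    · exact hs.isSubcubic_contract hG hr r
    · intro x hx hxr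
      rw [Set.ncard_eq_zero, Set.eq_empty_iff_forall_notMem]
      exact fun t ht => hxr (eq_of_contract_adj ht ((hmem x).mp hx))
    · exact fun h => absurd ((hmem r).mpr hr) h
  have h3 : 6 ≤ ∑ x ∈ T, (G.neighborSet x).ncard := by
    rw [hT, Finset.sum_image fun _ _ _ _ e => hs.inj e]
    have : ∀ i ∈ Finset.univ, 2 ≤ (G.neighborSet (s i)).ncard := fun i _ =>
      G.two_le_ncard (hs.adj _ _ (ne_add_fin_three i).1)
        (hs.adj _ _ (ne_add_fin_three i).2.1) (hs.inj.ne (ne_add_fin_three i).2.2)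
    simpa using Finset.sum_le_sum this
  omega

end IsContractibleTriangle

end SimpleGraph

namespace PartialEdgeColoring

open SimpleGraph

variable {V : Type*} {G : SimpleGraph V} {s : Fin 3 → V} {r : V}

section ExpandFun

open scoped Classical in
/-- The action of colour `i` after expanding `r` to the triangle `s`: the edge opposite to `s i`
gets colour `i`, and the edge of colour `i` at `r` is attached to `s i`. -/
noncomputable def expandFun (s : Fin 3 → V) (r : V) (i : Fin 3) (f : V → V) (x : V) : V :=
  if x = s i then (if f r = r then s i else f r)
  else if x = s (i + 1) then s (i + 2)
  else if x = s (i + 2) then s (i + 1)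
  else if f x = r then s i
  else f x

variable {i j : Fin 3} {f : V → V} {x : V}

open scoped Classical in
theorem expandFun_self : expandFun s r i f (s i) = if f r = r then s i else f r := by
  simp [expandFun]

theorem expandFun_of_ne (hs : Function.Injective s) (h : j ≠ i) :
    expandFun s r i f (s j) = s (-i - j) := by
  have : j = i + 1 ∧ -i - j = i + 2 ∨ j = i + 2 ∧ -i - j = i + 1 := by
    revert i j; decide
  rcases this with ⟨rfl, e⟩ | ⟨rfl, e⟩ <;> simp [expandFun, hs.eq_iff, e]

open scoped Classical in
theorem expandFun_of_notMem (hx : x ∉ Set.range s) :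
    expandFun s r i f x = if f x = r then s i else f x := by
  have h : ∀ j, x ≠ s j := fun j e => hx ⟨j, e.symm⟩
  simp [expandFun, h]

end ExpandFun

/-- Expand the contracted vertex `r` of a coloured graph back to a triangle. -/
noncomputable def expand (hs : G.IsContractibleTriangle s) (hr : r ∈ Set.range s)
    (c : PartialEdgeColoring (G.contract (Set.range s) r))
    (hc : ∀ i, c.σ i r ≠ r → G.Adj (s i) (c.σ i r)) : PartialEdgeColoring G where
  σ i := expandFun s r i (c.σ i)
  invol i x := by
    by_cases hx : x ∈ Set.range s
    · obtain ⟨j, rfl⟩ := hx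
      by_cases hji : j = i
      · subst hji
        rw [expandFun_self]
        split_ifs with h
        · rw [expandFun_self, if_pos h]
        · have := (exists_mem_adj_of_contract_adj hr (c.adj j r h)).1
          rw [expandFun_of_notMem this, c.invol, if_pos rfl]
      · have : -i - j ≠ i ∧ -i - (-i - j) = j := by revert i j; decide
        rw [expandFun_of_ne hs.inj hji, expandFun_of_ne hs.inj this.1, this.2]
    · rw [expandFun_of_notMem hx]
      have hxr : x ≠ r := fun e => hx (e ▸ hr)
      split_ifs with h
      · have : c.σ i r = x := ((c.invol i).eq_iff.mp h).symm
        rw [expandFun_self, this, if_neg hxr]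
      · have : c.σ i x ∉ Set.range s := fun hmem => by
          by_cases hfix : c.σ i x = x
          · exact hx (hfix ▸ hmem)
          · exact h (eq_of_contract_adj (c.adj i x hfix).symm hmem)
        rw [expandFun_of_notMem this, c.invol, if_neg hxr]
  adj i x hne := by
    by_cases hx : x ∈ Set.range s
    · obtain ⟨j, rfl⟩ := hx
      by_cases hji : j = i
      · subst hji
        rw [expandFun_self] at hne ⊢
        split_ifs at hne ⊢ with h
        · exact absurd rfl hne
        · exact hc j h
      · rw [expandFun_of_ne hs.inj hji]
        exact hs.adj _ _ (by clear hne; revert i j; decide)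
    · rw [expandFun_of_notMem hx] at hne ⊢
      split_ifs at hne ⊢ with h
      · have : c.σ i r = x := ((c.invol i).eq_iff.mp h).symm
        simpa only [this] using (hc i (by rw [this]; rintro rfl; exact hx hr)).symm
      · have hadj := c.adj i x hne
        exact adj_of_contract_adj hr hadj hx fun hmem => h (eq_of_contract_adj hadj.symm hmem)
  disj i j x hij hne := by
    have hout : ∀ k, c.σ k r ≠ r → c.σ k r ∉ Set.range s := fun k h =>
      (exists_mem_adj_of_contract_adj hr (c.adj k r h)).1
    by_cases hx : x ∈ Set.range s
    · obtain ⟨m, rfl⟩ := hx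
      by_cases hmi : m = i
      · subst hmi
        rw [expandFun_of_ne hs.inj hij]
        rw [expandFun_self] at hne ⊢
        split_ifs at hne ⊢ with h
        · exact absurd rfl hne
        · exact fun e => hout m h ⟨_, e.symm⟩
      rw [expandFun_of_ne hs.inj hmi] at hne ⊢
      by_cases hmj : m = j
      · subst hmj
        rw [expandFun_self]
        split_ifs with h
        · exact hne
        · exact fun e => hout m h ⟨_, e⟩
      · rw [expandFun_of_ne hs.inj hmj]
        exact hs.inj.ne fun e => hij (neg_injective (sub_left_injective e))
    · have hout' : ∀ k, c.σ k x ≠ r → c.σ k x ∉ Set.range s := fun k h hmem => by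
        by_cases hfix : c.σ k x = x
        · exact hx (hfix ▸ hmem)
        · exact h (eq_of_contract_adj (c.adj k x hfix).symm hmem)
      rw [expandFun_of_notMem hx] at hne ⊢
      rw [expandFun_of_notMem hx]
      split_ifs at hne ⊢ with h h' h'
      · exact fun e => hij (hs.inj e)
      · exact fun e => hout' j h' ⟨_, e⟩
      · exact fun e => hout' i h ⟨_, e.symm⟩
      · exact c.disj i j x hij hne

section Uncolored

variable {x y : V} {hs : G.IsContractibleTriangle s} {hr : r ∈ Set.range s}
  {c : PartialEdgeColoring (G.contract (Set.range s) r)}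
  {hc : ∀ i, c.σ i r ≠ r → G.Adj (s i) (c.σ i r)}

theorem notMem_of_expand_uncolored (h : (expand hs hr c hc).Uncolored x y)
    (hx : x ∈ Set.range s) : y ∉ Set.range s := by
  rintro ⟨k, rfl⟩
  obtain ⟨j, rfl⟩ := hx
  have hjk : j ≠ k := by rintro rfl; exact h.1.ne rfl
  have hj : j ≠ -j - k ∧ -(-j - k) - j = k := by clear h; revert j k; decide
  exact h.2 (-j - k) (by simp only [expand]; rw [expandFun_of_ne hs.inj hj.1, hj.2])

theorem apply_collapse_ne_of_expand_uncolored (h : (expand hs hr c hc).Uncolored x y)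
    (hy : y ∉ Set.range s) (i : Fin 3) : c.σ i (collapse (Set.range s) r x) ≠ y := by
  have hyr : y ≠ r := fun e => hy (e ▸ hr)
  intro e
  by_cases hx : x ∈ Set.range s
  · rw [collapse_of_mem hx] at e
    subst e
    obtain ⟨j, rfl⟩ := hx
    obtain rfl := hs.outer _ hy i j (hc i hyr).symm h.1.symm
    exact h.2 i (by simp only [expand]; rw [expandFun_self, if_neg hyr])
  · rw [collapse_of_notMem hx] at e
    exact h.2 i (by simp only [expand]; rw [expandFun_of_notMem hx, e, if_neg hyr])

theorem uncolored_collapse_of_expand_uncolored (h : (expand hs hr c hc).Uncolored x y) :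
    c.Uncolored (collapse (Set.range s) r x) (collapse (Set.range s) r y) := by
  wlog hy : y ∉ Set.range s generalizing x y
  · exact (this h.symm (notMem_of_expand_uncolored h.symm (not_not.mp hy))).symm
  have hyr : y ≠ r := fun e => hy (e ▸ hr)
  refine ⟨contract_adj_of_adj h.1 fun e => ?_, fun i => ?_⟩
  · rw [collapse_of_notMem hy] at e
    by_cases hx : x ∈ Set.range s
    · rw [collapse_of_mem hx] at e; exact hyr e.symm
    · rw [collapse_of_notMem hx] at e; exact h.1.ne e
  · rw [collapse_of_notMem hy]
    exact apply_collapse_ne_of_expand_uncolored h hy i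

theorem eq_of_collapse_eq {x' y' : V} (h : G.Adj x y) (h' : G.Adj x' y')
    (hs : G.IsContractibleTriangle s) (hr : r ∈ Set.range s) (hy : y ∉ Set.range s)
    (ex : collapse (Set.range s) r x = collapse (Set.range s) r x')
    (ey : collapse (Set.range s) r y = collapse (Set.range s) r y') : x = x' ∧ y = y' := by
  obtain rfl : y = y' := by unfold collapse at ey; grind
  refine ⟨?_, rfl⟩
  by_cases hx : x ∈ Set.range s
  · have hx' : x' ∈ Set.range s := by unfold collapse at ex; grind
    obtain ⟨i, rfl⟩ := hx
    obtain ⟨j, rfl⟩ := hx'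
    rw [hs.outer _ hy i j h.symm h'.symm]
  · unfold collapse at ex; grind

theorem card_uncoloredDarts_expand_le [Fintype V] :
    (expand hs hr c hc).uncoloredDarts.card ≤ c.uncoloredDarts.card := by
  refine Finset.card_le_card_of_injOn
    (Prod.map (collapse (Set.range s) r) (collapse (Set.range s) r)) ?_ ?_
  · rintro ⟨x, y⟩ h
    simp only [Finset.mem_coe, mem_uncoloredDarts] at h ⊢
    exact uncolored_collapse_of_expand_uncolored h
  · rintro ⟨x, y⟩ h ⟨x', y'⟩ h' e
    simp only [Finset.mem_coe, mem_uncoloredDarts] at h h'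
    simp only [Prod.map_apply, Prod.mk.injEq] at e ⊢
    by_cases hy : y ∈ Set.range s
    · exact (eq_of_collapse_eq h.1.symm h'.1.symm hs hr
        (notMem_of_expand_uncolored h.symm hy) e.2 e.1).symm
    · exact eq_of_collapse_eq h.1 h'.1 hs hr hy e.1 e.2

end Uncolored

/-- The outer edges at a contracted triangle can be matched with its corners. -/
theorem exists_perm_adj [Finite V] (hs : G.IsContractibleTriangle s) (hG : G.IsSubcubic)
    (hr : r ∈ Set.range s) (c : PartialEdgeColoring (G.contract (Set.range s) r)) :
    ∃ β : Equiv.Perm (Fin 3), ∀ i, c.σ i r ≠ r → G.Adj (s (β i)) (c.σ i r) := by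
  have h : ∀ i, c.σ i r ≠ r → c.σ i r ∉ Set.range s ∧ ∃ j, G.Adj (s j) (c.σ i r) := by
    intro i hi
    obtain ⟨h, _, ⟨j, rfl⟩, hj⟩ := exists_mem_adj_of_contract_adj hr (c.adj i r hi)
    exact ⟨h, j, hj⟩
  choose! hout g hg using h
  obtain ⟨β, hβ⟩ := Set.MapsTo.exists_equiv_extend_of_card_eq (t := Finset.univ)
    (s := {i | c.σ i r ≠ r}) (f := g) (by simp) (fun _ _ => Finset.mem_coe.mpr (Finset.mem_univ _))
    fun i hi j hj e => by
      by_contra hij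
      exact c.disj i j r hij hi (hs.outer_unique hG (hout i hi) (hout j hj) (hg i hi)
        (e ▸ hg j hj))
  refine ⟨β.trans (Equiv.subtypeUnivEquiv Finset.mem_univ), fun i hi => ?_⟩
  have := hβ i hi
  simpa [this] using hg i hi

end PartialEdgeColoring

namespace SimpleGraph

variable {V : Type*} [Fintype V]

theorem IsContractibleTriangle.exists_card_uncoloredDarts_le {G : SimpleGraph V}
    {s : Fin 3 → V} {r : V} (hs : G.IsContractibleTriangle s) (hG : G.IsSubcubic)
    (hr : r ∈ Set.range s) (c : PartialEdgeColoring (G.contract (Set.range s) r)) :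
    ∃ c' : PartialEdgeColoring G, c'.uncoloredDarts.card ≤ c.uncoloredDarts.card := by
  obtain ⟨β, hβ⟩ := c.exists_perm_adj hs hG hr
  have hrange := β.surjective.range_comp s
  generalize Set.range s = S at *
  subst hrange
  exact ⟨_, c.card_uncoloredDarts_expand_le (hs := hs.comp_perm β) (hr := hr) (hc := hβ)⟩

theorem IsSubcubic.hasSmallDefect {G : SimpleGraph V} (hG : G.IsSubcubic)
    (hconn : G.IsConnectedOnEdges) : G.HasSmallDefect := by
  induction hn : ∑ x, (G.neighborSet x).ncard using Nat.strong_induction_on generalizing G with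
  | _ n ih =>
    by_cases hT : ∃ s, G.IsContractibleTriangle s
    · obtain ⟨s, hs⟩ := hT
      have hr : s 0 ∈ Set.range s := ⟨0, rfl⟩
      have hle := hs.sum_ncard_contract_add_three_le hG hr
      obtain ⟨c, hc⟩ := ih _ (by omega) (hs.isSubcubic_contract hG hr)
        (hconn.contract _ _) rfl
      obtain ⟨c', hc'⟩ := hs.exists_card_uncoloredDarts_le hG hr c
      exact ⟨c', .inl (by omega)⟩
    · exact hasSmallDefect_of_forall_not_isContractibleTriangle hG hconn (not_exists.mp hT)

end SimpleGraph

theorem SimpleGraph.sum_ncard_neighborSet {V : Type*} [Fintype V] (G : SimpleGraph V) :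
    ∑ x, (G.neighborSet x).ncard = 2 * G.edgeSet.ncard := by
  classical
  rw [← G.coe_edgeFinset, Set.ncard_coe_finset, ← G.sum_degrees_eq_twice_card_edges]
  refine Finset.sum_congr rfl fun x _ => ?_
  rw [← G.card_neighborSet_eq_degree, ← Nat.card_eq_fintype_card, Nat.card_coe_set_eq]

namespace PartialEdgeColoring

variable {V : Type*} {G : SimpleGraph V} (c : PartialEdgeColoring G)

/-- The subgraph of the coloured edges. -/
def coloredGraph : SimpleGraph V where
  Adj x y := x ≠ y ∧ ∃ i, c.σ i x = y
  symm := ⟨fun x y ⟨hne, i, hi⟩ => ⟨hne.symm, i, by rw [← hi, c.invol]⟩⟩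
  loopless := ⟨fun _ h => h.1 rfl⟩

theorem coloredGraph_le : c.coloredGraph ≤ G := by
  rintro x _ ⟨hne, i, rfl⟩
  exact c.adj i x hne.symm

theorem sdiff_coloredGraph_adj {x y : V} :
    (G \ c.coloredGraph).Adj x y ↔ c.Uncolored x y := by
  rw [SimpleGraph.sdiff_adj]
  refine and_congr_right fun h => ?_
  simp [coloredGraph, h.ne]

theorem exists_isProperEdgeColoring : ∃ f, IsProperEdgeColoring c.coloredGraph 3 f := by
  have key : ∀ e : Sym2 V, ∃ i : Fin 3, e ∈ c.coloredGraph.edgeSet →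
      ∀ x y, e = s(x, y) → c.σ i x = y := by
    intro e
    by_cases he : e ∈ c.coloredGraph.edgeSet
    · induction e with
      | _ x y =>
        obtain ⟨i, hi⟩ := (SimpleGraph.mem_edgeSet _).mp he |>.2
        refine ⟨i, fun _ x' y' h => ?_⟩
        rcases Sym2.eq_iff.mp h with ⟨rfl, rfl⟩ | ⟨rfl, rfl⟩
        · exact hi
        · rw [← hi, c.invol]
    · exact ⟨0, fun h => absurd h he⟩
  choose f hf using key
  refine ⟨fun e => f e, fun e _ => (f e).isLt, ?_⟩
  rintro e₁ h₁ e₂ h₂ hne ⟨v, ⟨x, rfl⟩, ⟨y, rfl⟩⟩ heq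
  apply hne
  rw [← hf _ h₁ v x rfl, ← hf _ h₂ v y rfl, Fin.ext heq]

theorem card_uncoloredDarts_add [Fintype V] :
    c.uncoloredDarts.card + 2 * c.coloredGraph.edgeSet.ncard = 2 * G.edgeSet.ncard := by
  classical
  have h1 : c.uncoloredDarts.card = 2 * (G \ c.coloredGraph).edgeSet.ncard := by
    rw [← SimpleGraph.sum_ncard_neighborSet,
      Finset.card_eq_sum_card_fiberwise (f := Prod.fst) (t := Finset.univ) (by simp)]
    refine Finset.sum_congr rfl fun x _ => ?_
    have himage : ({d ∈ c.uncoloredDarts | d.1 = x} : Finset (V × V)) =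
        Prod.mk x '' (G \ c.coloredGraph).neighborSet x := by
      ext ⟨x', y⟩
      simp only [Finset.coe_filter, mem_uncoloredDarts, Set.mem_ofPred_eq, Set.mem_image,
        SimpleGraph.mem_neighborSet, sdiff_coloredGraph_adj, Prod.mk.injEq]
      grind
    rw [← Set.ncard_coe_finset, himage, Set.ncard_image_of_injective _ (Prod.mk_right_injective x)]
  have h2 := Set.ncard_sdiff_add_ncard_of_subset
    (SimpleGraph.edgeSet_subset_edgeSet.mpr c.coloredGraph_le)
  rw [← SimpleGraph.edgeSet_sdiff] at h2
  omega

end PartialEdgeColoring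

/-- Every connected simple subcubic graph not isomorphic to `B₃` has a 3-edge-colorable
subgraph with at least `(13/15)·|E|` edges. -/
theorem stmt10 {V : Type*} [Fintype V] (G : SimpleGraph V)
    (hconn : G.Connected) (hdeg : ∀ v : V, (G.neighborSet v).ncard ≤ 3)
    (hniso : IsEmpty (G ≃g B3)) :
    ∃ H : SimpleGraph V, H ≤ G ∧ (∃ c, IsProperEdgeColoring H 3 c) ∧
      (13 : ℚ) / 15 * G.edgeSet.ncard ≤ H.edgeSet.ncard := by
  obtain ⟨c, hc⟩ := SimpleGraph.IsSubcubic.hasSmallDefect hdeg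
    fun x _ y _ _ _ => hconn.preconnected x y
  have hle : 15 * c.uncoloredDarts.card ≤ 2 * ∑ x, (G.neighborSet x).ncard := by
    refine hc.resolve_right fun h => ?_
    exact not_isEmpty_iff.mpr (h.2.2 hconn) hniso
  refine ⟨c.coloredGraph, c.coloredGraph_le, c.exists_isProperEdgeColoring, ?_⟩
  rw [G.sum_ncard_neighborSet] at hle
  have hadd := c.card_uncoloredDarts_add
  have : 13 * G.edgeSet.ncard ≤ 15 * c.coloredGraph.edgeSet.ncard := by omega
  have : (13 : ℚ) * G.edgeSet.ncard ≤ 15 * c.coloredGraph.edgeSet.ncard := by exact_mod_cast this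
  linarith
end
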